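/- For each dimension n, there are only finitely many isomorphism classes of pairs of groups (Γ, N) such that Γ is an n-space group and N is a normal subgroup of Γ such that Γ/N is a space group (equivalently, N is a complete normal subgroup of Γ); that is, there exists a finite list of such pairs (Γ₁, N₁), …, (Γ_k, N_k) so that every such pair (Γ, N) admits a group isomorphism ζ : Γ → Γ_i with ζ(N) = N_i for some i. -/

import Mathlib

noncomputable section

/-- The translation `x ↦ a + x` of a normed additive group, as an isometry. -/
def transIso {X : Type*} [SeminormedAddCommGroup X] (a : X) : X ≃ᵢ X :=
  IsometryEquiv.constVAdd a

@[simp] lemma transIso_apply {X : Type*} [SeminormedAddCommGroup X] (a x : X) :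
    transIso a x = a + x := rfl

/-- `parts φ a A` means that the isometry `φ` is `a + A`, i.e. `φ x = a + A x` for all `x`. -/
def parts {X : Type*} [NormedAddCommGroup X] [InnerProductSpace ℝ X]
    (φ : X ≃ᵢ X) (a : X) (A : X ≃ₗᵢ[ℝ] X) : Prop :=
  ∀ x, φ x = a + A x

/-- The span of a group of isometries: the real span of the set of translation vectors of
the translations belonging to the group. -/
def spanOf {X : Type*} [NormedAddCommGroup X] [InnerProductSpace ℝ X]
    (H : Subgroup (X ≃ᵢ X)) : Submodule ℝ X :=
  Submodule.span ℝ {a : X | transIso a ∈ H}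

/-- A space group: a group of isometries acting discontinuously (the discreteness condition)
with compact quotient (expressed by a compact set meeting every orbit). -/
def IsSpaceGroup {X : Type*} [MetricSpace X] (Γ : Subgroup (X ≃ᵢ X)) : Prop :=
  (∀ K : Set X, IsCompact K →
    {γ : X ≃ᵢ X | γ ∈ Γ ∧ ((γ : X → X) '' K ∩ K).Nonempty}.Finite) ∧
  ∃ K : Set X, IsCompact K ∧ ∀ x : X, ∃ γ ∈ Γ, (γ : X → X) x ∈ K

/-- `N` is a complete normal subgroup of `Γ`: it is normal in `Γ` and consists exactly of
those `a + A ∈ Γ` with `a ∈ Span N` and `A` fixing `(Span N)ᗮ` pointwise. -/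
def IsCompleteNormal {X : Type*} [NormedAddCommGroup X] [InnerProductSpace ℝ X]
    (Γ N : Subgroup (X ≃ᵢ X)) : Prop :=
  N ≤ Γ ∧ (∀ γ ∈ Γ, ∀ ν ∈ N, γ * ν * γ⁻¹ ∈ N) ∧
  ∀ φ ∈ Γ, ∀ (a : X) (A : X ≃ₗᵢ[ℝ] X), parts φ a A →
    (φ ∈ N ↔ a ∈ spanOf N ∧ ∀ w ∈ (spanOf N)ᗮ, A w = w)

/-- The real span of the set of translation vectors of the central translations of `N`,
i.e. `Span(Z(N))`. -/
def centerSpan {X : Type*} [NormedAddCommGroup X] [InnerProductSpace ℝ X]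
    (N : Subgroup (X ≃ᵢ X)) : Submodule ℝ X :=
  Submodule.span ℝ
    {u : X | ∃ h : transIso u ∈ N, (⟨transIso u, h⟩ : N) ∈ Subgroup.center N}

section IntSeminorm

/-- An integer valued seminorm on an abelian group. -/
structure IsIntSeminorm {L : Type*} [AddCommGroup L] (N : L → ℤ) : Prop where
  add_le : ∀ x y, N (x + y) ≤ N x + N y
  smul_eq : ∀ (c : ℤ) x, N (c • x) = |c| * N x

variable {L : Type*} [AddCommGroup L] {N : L → ℤ}

lemma IsIntSeminorm.map_zero (hN : IsIntSeminorm N) : N 0 = 0 := by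
  simpa using hN.smul_eq 0 0

lemma IsIntSeminorm.map_neg (hN : IsIntSeminorm N) (x : L) : N (-x) = N x := by
  simpa using hN.smul_eq (-1) x

lemma IsIntSeminorm.nonneg (hN : IsIntSeminorm N) (x : L) : 0 ≤ N x := by
  have h := hN.add_le x (-x)
  rw [hN.map_neg, add_neg_cancel, hN.map_zero] at h
  linarith

lemma IsIntSeminorm.sub_le (hN : IsIntSeminorm N) (x y : L) : N (x - y) ≤ N x + N y := by
  rw [sub_eq_add_neg, ← hN.map_neg y]
  exact hN.add_le _ _

lemma IsIntSeminorm.sum_smul_le (hN : IsIntSeminorm N) {k : ℕ} (c : Fin k → ℤ) (v : Fin k → L)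
    {a B : ℤ} (ha : 0 ≤ a) (hc : ∀ i, |c i| ≤ a) (hv : ∀ i, N (v i) ≤ B) :
    N (∑ i, c i • v i) ≤ a * (k * B) := by
  calc N (∑ i, c i • v i) ≤ ∑ i, N (c i • v i) :=
        Finset.le_sum_of_subadditive N hN.map_zero.le hN.add_le _ _
    _ ≤ ∑ _i : Fin k, a * B := by
        refine Finset.sum_le_sum fun i _ => ?_
        rw [hN.smul_eq]
        exact mul_le_mul (hc i) (hv i) (hN.nonneg _) ha
    _ = a * (k * B) := by simp; ring

lemma IsIntSeminorm.comp (hN : IsIntSeminorm N) {M : Type*} [AddCommGroup M] (f : M →ₗ[ℤ] L) :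
    IsIntSeminorm fun x => N (f x) where
  add_le x y := by rw [map_add]; exact hN.add_le _ _
  smul_eq c x := by rw [map_smul]; exact hN.smul_eq _ _

lemma abs_emod_le (a b : ℤ) (hb : b ≠ 0) : |a % b| ≤ |b| := by
  rw [abs_of_nonneg (Int.emod_nonneg a hb)]
  exact (Int.emod_lt_abs a hb).le

/-- In a lattice with a basis of vectors of length at most `C` times the minimum, the
coordinates of the vectors which are that short are bounded. -/
lemma abs_repr_le_of_short (hN : IsIntSeminorm N) {k : ℕ} (b : Module.Basis (Fin k) ℤ L)
    {lam : ℤ} (hlam : 0 < lam) (hmin : ∀ x, x ≠ 0 → lam ≤ N x) (C : ℕ)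
    (hb : ∀ i, N (b i) ≤ C * lam) {x : L} (hx : N x ≤ C * lam) (i : Fin k) :
    |b.repr x i| ≤ (((2 * C * (k + 1) + 1) ^ k : ℕ) : ℤ) := by
  set q : ℕ := 2 * C * (k + 1) + 1 with hq
  set a : ℤ := b.repr x i with ha
  rcases eq_or_ne a 0 with h0 | h0
  · rw [h0]; simp
  have hapos : 0 < |a| := abs_pos.2 h0
  let y : Fin a.natAbs → L := fun s => ∑ j, ((s : ℤ) * b.repr x j / a) • b j
  have hyrepr : ∀ s j, b.repr (y s) j = (s : ℤ) * b.repr x j / a := by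
    intro s j
    simp only [y]
    rw [b.repr_sum_self]
  have hyN : ∀ s, N (y s) ≤ C * (k + 1) * lam := by
    intro s
    have h1 : a • y s = (s : ℤ) • x - ∑ j, ((s : ℤ) * b.repr x j % a) • b j := by
      rw [eq_sub_iff_add_eq]
      simp only [y]
      conv_rhs => rw [← b.sum_repr x]
      rw [Finset.smul_sum, Finset.smul_sum, ← Finset.sum_add_distrib]
      refine Finset.sum_congr rfl fun j _ => ?_
      rw [smul_smul, smul_smul, ← add_smul, Int.mul_ediv_add_emod]
    have h2 : |a| * N (y s) ≤ |a| * (C * lam) + |a| * (k * (C * lam)) := by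
      rw [← hN.smul_eq, h1]
      refine (hN.sub_le _ _).trans (add_le_add ?_ ?_)
      · rw [hN.smul_eq]
        have hs : |((s : ℕ) : ℤ)| ≤ |a| := by
          have := s.2
          rw [Int.abs_eq_natAbs a]
          simp only [Nat.abs_cast]
          omega
        exact mul_le_mul hs hx (hN.nonneg _) hapos.le
      · exact hN.sum_smul_le _ _ hapos.le (fun j => abs_emod_le _ _ h0) hb
    have h3 : |a| * N (y s) ≤ |a| * (C * (k + 1) * lam) := by linarith
    exact le_of_mul_le_mul_left h3 hapos
  clear_value y
  have hqpos : 0 < q := by omega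
  have : NeZero q := ⟨hqpos.ne'⟩
  let f : Fin a.natAbs → (Fin k → ZMod q) := fun s j => ((b.repr (y s) j : ℤ) : ZMod q)
  have hf : Function.Injective f := by
    intro s t hst
    have hdvd : ∀ j, ∃ c : ℤ, b.repr (y s) j - b.repr (y t) j = q * c := by
      intro j
      have h := congrFun hst j
      simp only [f] at h
      rw [ZMod.intCast_eq_intCast_iff_dvd_sub] at h
      obtain ⟨c, hc⟩ := h
      exact ⟨-c, by linarith⟩
    choose c hc using hdvd
    have hz : y s - y t = (q : ℤ) • ∑ j, c j • b j := by
      apply b.repr.injective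
      ext j
      rw [map_smul, map_sub, Finsupp.sub_apply, Finsupp.smul_apply, b.repr_sum_self, hc j]
      simp
    have hz0 : ∑ j, c j • b j = 0 := by
      by_contra hne
      have h1 := hmin _ hne
      have h2 : (q : ℤ) * N (∑ j, c j • b j) ≤ 2 * (C * (k + 1) * lam) := by
        have h3 := hN.sub_le (y s) (y t)
        rw [hz, hN.smul_eq, Nat.abs_cast] at h3
        linarith [hyN s, hyN t]
      have h4 : (q : ℤ) * lam ≤ q * N (∑ j, c j • b j) :=
        mul_le_mul_of_nonneg_left h1 (by positivity)
      have h5 : (q : ℤ) = 2 * C * (k + 1) + 1 := by rw [hq]; push_cast; ring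
      rw [h5] at h4 h2
      nlinarith
    rw [hz0, smul_zero, sub_eq_zero] at hz
    have h6 := hyrepr s i
    rw [hz, hyrepr t i, ← ha, Int.mul_ediv_cancel _ h0, Int.mul_ediv_cancel _ h0] at h6
    exact Fin.ext (by exact_mod_cast h6.symm)
  have hcard := Fintype.card_le_of_injective f hf
  simp only [Fintype.card_fin, Fintype.card_fun, ZMod.card] at hcard
  rw [Int.abs_eq_natAbs]
  exact_mod_cast hcard

end IntSeminorm

section Saturation

variable {L : Type*} [AddCommGroup L]

/-- A subgroup of an abelian group is saturated if the quotient is torsion free. -/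
def IsSaturated (U : Submodule ℤ L) : Prop :=
  ∀ c : ℤ, c ≠ 0 → ∀ x, c • x ∈ U → x ∈ U

/-- The elements with a nonzero multiple in `U`. -/
def saturation (U : Submodule ℤ L) : Submodule ℤ L where
  carrier := {x | ∃ c : ℤ, c ≠ 0 ∧ c • x ∈ U}
  zero_mem' := ⟨1, one_ne_zero, by simp⟩
  add_mem' := by
    rintro x y ⟨c, hc, hx⟩ ⟨d, hd, hy⟩
    refine ⟨c * d, mul_ne_zero hc hd, ?_⟩
    rw [smul_add]
    refine add_mem ?_ ?_
    · rw [mul_comm, mul_smul]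
      exact U.smul_mem _ hx
    · rw [mul_smul]
      exact U.smul_mem _ hy
  smul_mem' := by
    rintro a x ⟨c, hc, hx⟩
    refine ⟨c, hc, ?_⟩
    rw [smul_comm]
    exact U.smul_mem _ hx

lemma le_saturation (U : Submodule ℤ L) : U ≤ saturation U :=
  fun x hx => ⟨1, one_ne_zero, by simpa using hx⟩

lemma isSaturated_saturation (U : Submodule ℤ L) : IsSaturated (saturation U) := by
  rintro c hc x ⟨d, hd, hx⟩
  exact ⟨d * c, mul_ne_zero hd hc, by rwa [mul_smul]⟩

lemma IsSaturated.saturation_le {U V : Submodule ℤ L} (hV : IsSaturated V) (h : U ≤ V) :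
    saturation U ≤ V := by
  rintro x ⟨c, hc, hx⟩
  exact hV c hc x (h hx)

lemma isSaturated_bot [Module.Free ℤ L] : IsSaturated (⊥ : Submodule ℤ L) := by
  intro c hc x hx
  rw [Submodule.mem_bot] at hx ⊢
  exact (smul_eq_zero.1 hx).resolve_left hc

lemma IsSaturated.isTorsionFree {U : Submodule ℤ L} (hU : IsSaturated U) :
    Module.IsTorsionFree ℤ (L ⧸ U) := by
  refine Module.IsTorsionFree.of_smul_eq_zero fun c m h => ?_
  obtain ⟨x, rfl⟩ := U.mkQ_surjective m
  by_cases hc : c = 0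
  · exact Or.inl hc
  · right
    rw [← map_smul, Submodule.mkQ_apply, Submodule.Quotient.mk_eq_zero] at h
    rw [Submodule.mkQ_apply, Submodule.Quotient.mk_eq_zero]
    exact hU c hc x h

lemma IsSaturated.free [Module.Finite ℤ L] {U : Submodule ℤ L} (hU : IsSaturated U) :
    Module.Free ℤ (L ⧸ U) :=
  have := hU.isTorsionFree
  Module.free_of_finite_type_torsion_free'

lemma IsSaturated.exists_dual [Module.Finite ℤ L] {U : Submodule ℤ L} (hU : IsSaturated U)
    {s : L} (hs : s ∉ U) : ∃ φ : L →ₗ[ℤ] ℤ, (∀ u ∈ U, φ u = 0) ∧ φ s ≠ 0 := by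
  have := hU.free
  let b := Module.Free.chooseBasis ℤ (L ⧸ U)
  have hne : b.repr (U.mkQ s) ≠ 0 := by
    intro h
    rw [LinearEquiv.map_eq_zero_iff, Submodule.mkQ_apply, Submodule.Quotient.mk_eq_zero] at h
    exact hs h
  obtain ⟨i, hi⟩ := Finsupp.ne_iff.1 hne
  refine ⟨(b.coord i).comp U.mkQ, fun u hu => ?_, by simpa using hi⟩
  have : U.mkQ u = 0 := by rwa [Submodule.mkQ_apply, Submodule.Quotient.mk_eq_zero]
  rw [LinearMap.comp_apply, this, map_zero]

/-- Bounds for the lengths of a basis built from generators of a subgroup of finite index. -/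
def basisConst : ℕ → ℕ
  | 0 => 1
  | k + 1 => 1 + (k + 1) * basisConst k

lemma basisConst_le_succ (k : ℕ) : basisConst k ≤ basisConst (k + 1) := by
  simp only [basisConst]
  nlinarith

lemma basisConst_mono : Monotone basisConst := monotone_nat_of_le_succ basisConst_le_succ

lemma exists_short_basis_succ [Module.Finite ℤ L] {N : L → ℤ} (hN : IsIntSeminorm N)
    {lam : ℤ} {U : Submodule ℤ L} (hU : IsSaturated U) {k : ℕ} (b : Module.Basis (Fin k) ℤ U)
    (hb : ∀ i, N (b i) ≤ basisConst k * lam) {s : L} (hs : s ∉ U) (hsN : N s ≤ lam) :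
    ∃ b' : Module.Basis (Fin (k + 1)) ℤ (saturation (U ⊔ Submodule.span ℤ {s})),
      ∀ i, N (b' i) ≤ basisConst (k + 1) * lam := by
  set U' := saturation (U ⊔ Submodule.span ℤ {s}) with hU'
  have hlam : 0 ≤ lam := (hN.nonneg s).trans hsN
  have hUU' : U ≤ U' := le_sup_left.trans (le_saturation _)
  have hsU' : s ∈ U' := le_saturation _ (Submodule.mem_sup_right (Submodule.mem_span_singleton_self s))
  obtain ⟨φ, hφU, hφs⟩ := hU.exists_dual hs
  have hker : ∀ x ∈ U', φ x = 0 → x ∈ U := by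
    rintro x ⟨c, hc, hx⟩ hx0
    obtain ⟨u, hu, v, hv, huv⟩ := Submodule.mem_sup.1 hx
    obtain ⟨a, rfl⟩ := Submodule.mem_span_singleton.1 hv
    have h1 := congrArg φ huv
    rw [map_add, map_smul, map_smul, hφU u hu, hx0, zero_add, smul_zero, smul_eq_mul] at h1
    rcases mul_eq_zero.1 h1 with h | h
    · rw [h, zero_smul, add_zero] at huv
      exact hU c hc x (huv ▸ hu)
    · exact absurd h hφs
  obtain ⟨g, hg⟩ := (IsPrincipalIdealRing.principal (U'.map φ)).principal
  have hgmem : g ∈ U'.map φ := by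
    rw [hg]
    exact Submodule.mem_span_singleton_self g
  obtain ⟨e, heU', he⟩ := hgmem
  have hmult : ∀ x ∈ U', ∃ t : ℤ, φ x = t * g := by
    intro x hx
    have h : φ x ∈ U'.map φ := ⟨x, hx, rfl⟩
    rw [hg] at h
    obtain ⟨t, ht⟩ := Submodule.mem_span_singleton.1 h
    exact ⟨t, by rw [← ht, smul_eq_mul]⟩
  obtain ⟨t, ht⟩ := hmult s hsU'
  have ht0 : t ≠ 0 := by
    rintro rfl
    exact hφs (by rw [ht, zero_mul])
  have hg0 : g ≠ 0 := by
    rintro rfl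
    exact hφs (by rw [ht, mul_zero])
  have huU : s - t • e ∈ U := by
    refine hker _ (sub_mem hsU' (U'.smul_mem t heU')) ?_
    rw [map_sub, map_smul, he, ht, smul_eq_mul, sub_self]
  set u : U := ⟨s - t • e, huU⟩ with hu
  set w : U := ∑ i, (b.repr u i / t) • b i with hw
  have hφe' : φ (e + w) = g := by rw [map_add, hφU _ w.2, he, add_zero]
  have key : t • (e + (w : L)) = s - ((∑ i, (b.repr u i % t) • b i : U) : L) := by
    have h1 : t • w + ∑ i, (b.repr u i % t) • b i = u := by
      conv_rhs => rw [← b.sum_repr u]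
      rw [hw, Finset.smul_sum, ← Finset.sum_add_distrib]
      refine Finset.sum_congr rfl fun i _ => ?_
      rw [smul_smul, ← add_smul, Int.mul_ediv_add_emod]
    have h2 : t • (w : L) + ((∑ i, (b.repr u i % t) • b i : U) : L) = s - t • e := by
      have := congrArg (Subtype.val : U → L) h1
      simpa only [Submodule.coe_add, Submodule.coe_smul, hu] using this
    rw [smul_add, eq_sub_iff_add_eq, add_assoc, h2]
    abel
  have heN : N (e + w) ≤ basisConst (k + 1) * lam := by
    have hNU := hN.comp U.subtype
    have h1 : |t| * N (e + w) ≤ lam + |t| * (k * (basisConst k * lam)) := by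
      rw [← hN.smul_eq, key]
      exact (hN.sub_le _ _).trans (add_le_add hsN
        (hNU.sum_smul_le _ _ (abs_nonneg t) (fun i => abs_emod_le _ _ ht0) hb))
    have h2 : 1 ≤ |t| := Int.one_le_abs ht0
    have h3 : |t| * N (e + w) ≤ |t| * (lam + k * (basisConst k * lam)) := by nlinarith
    have h4 := le_of_mul_le_mul_left h3 (by linarith)
    refine h4.trans ?_
    have h5 : 0 ≤ (basisConst k : ℤ) * lam := by positivity
    simp only [basisConst]
    push_cast
    nlinarith
  refine ⟨Module.Basis.mkFinConsOfLE (e + w) (add_mem heU' (hUU' w.2)) b hUU' ?_ ?_, ?_⟩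
  · intro c x hx h
    have h1 := congrArg φ h
    rw [map_add, map_smul, hφe', hφU x hx, map_zero, add_zero, smul_eq_mul] at h1
    exact (mul_eq_zero.1 h1).resolve_right hg0
  · intro z hz
    obtain ⟨c, hc⟩ := hmult z hz
    refine ⟨-c, hker _ (add_mem hz (U'.smul_mem _ (add_mem heU' (hUU' w.2)))) ?_⟩
    rw [map_add, map_smul, hφe', hc, smul_eq_mul]
    ring
  · intro i
    rw [Module.Basis.coe_mkFinConsOfLE]
    refine Fin.cases ?_ (fun j => ?_) i
    · simpa using heN
    · simp only [Fin.cons_succ, Function.comp_apply, Submodule.coe_inclusion]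
      refine (hb j).trans (mul_le_mul_of_nonneg_right ?_ hlam)
      exact_mod_cast basisConst_le_succ k

/-- The saturation of the span of a set of short vectors has a basis of short vectors. -/
lemma exists_short_basis [Module.Finite ℤ L] [Module.Free ℤ L] {N : L → ℤ}
    (hN : IsIntSeminorm N) {lam : ℤ} (hlam : 0 ≤ lam) (S : Set L) (hS : ∀ s ∈ S, N s ≤ lam) :
    ∃ (k : ℕ) (_ : k ≤ Module.finrank ℤ L)
      (b : Module.Basis (Fin k) ℤ (saturation (Submodule.span ℤ S))),
      ∀ i, N (b i) ≤ basisConst (Module.finrank ℤ L) * lam := by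
  set T := saturation (Submodule.span ℤ S) with hT
  let Q : ℕ → Prop := fun k => ∃ U : Submodule ℤ L, U ≤ T ∧ IsSaturated U ∧
    ∃ b : Module.Basis (Fin k) ℤ U, ∀ i, N (b i) ≤ basisConst k * lam
  have hQle : ∀ k, Q k → k ≤ Module.finrank ℤ L := by
    rintro k ⟨U, -, -, b, -⟩
    have h1 := Module.finrank_eq_card_basis b
    rw [Fintype.card_fin] at h1
    rw [← h1]
    exact Submodule.finrank_le U
  have hQ0 : Q 0 :=
    ⟨⊥, bot_le, isSaturated_bot, Module.Basis.empty _, fun i => i.elim0⟩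
  classical
  set k := Nat.findGreatest Q (Module.finrank ℤ L) with hk
  have hQk : Q k := Nat.findGreatest_spec (Nat.zero_le _) hQ0
  have hmax : ¬ Q (k + 1) := fun h =>
    absurd (Nat.le_findGreatest (hQle _ h) h) (by omega)
  obtain ⟨U, hUT, hU, b, hb⟩ := hQk
  have hSU : S ⊆ U := by
    intro s hs
    by_contra hsU
    obtain ⟨b', hb'⟩ := exists_short_basis_succ hN hU b hb hsU (hS s hs)
    refine hmax ⟨_, ?_, isSaturated_saturation _, b', hb'⟩
    refine (isSaturated_saturation _).saturation_le (sup_le hUT ?_)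
    rw [Submodule.span_singleton_le_iff_mem]
    exact le_saturation _ (Submodule.subset_span hs)
  have hUeq : U = T := le_antisymm hUT (hU.saturation_le (Submodule.span_le.2 hSU))
  subst hUeq
  refine ⟨k, Nat.findGreatest_le _, b, fun i => (hb i).trans (mul_le_mul_of_nonneg_right ?_ hlam)⟩
  exact_mod_cast basisConst_mono (Nat.findGreatest_le _)

end Saturation

section IntegralRepresentation

variable {G : Type} [Group G] {L : Type} [AddCommGroup L]

/-- The restriction of an integral representation to an invariant subgroup. -/
def subRep (ρ : G →* Module.End ℤ L) (W : Submodule ℤ L) (hW : ∀ g, ∀ x ∈ W, ρ g x ∈ W) :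
    G →* Module.End ℤ W where
  toFun g := (ρ g).restrict (hW g)
  map_one' := by ext x; simp
  map_mul' g h := by ext x; simp

/-- The quotient of an integral representation by an invariant subgroup. -/
def quotRep (ρ : G →* Module.End ℤ L) (W : Submodule ℤ L) (hW : ∀ g, ∀ x ∈ W, ρ g x ∈ W) :
    G →* Module.End ℤ (L ⧸ W) where
  toFun g := W.mapQ W (ρ g) (hW g)
  map_one' := by
    apply Submodule.linearMap_qext
    ext x
    simp
  map_mul' g h := by
    apply Submodule.linearMap_qext
    ext x
    simp

lemma coe_subRep_apply (ρ : G →* Module.End ℤ L) (W : Submodule ℤ L)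
    (hW : ∀ g, ∀ x ∈ W, ρ g x ∈ W) (g : G) (x : W) : (subRep ρ W hW g x : L) = ρ g x := rfl

lemma quotRep_mkQ (ρ : G →* Module.End ℤ L) (W : Submodule ℤ L)
    (hW : ∀ g, ∀ x ∈ W, ρ g x ∈ W) (g : G) (x : L) :
    quotRep ρ W hW g (W.mkQ x) = W.mkQ (ρ g x) := rfl

/-- In the basis `b` all matrices of the representation `ρ` have entries bounded by `B`. -/
def EntriesLE (ρ : G →* Module.End ℤ L) {ι : Type*} (b : Module.Basis ι ℤ L) (B : ℕ) : Prop :=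
  ∀ g i j, |b.repr (ρ g (b j)) i| ≤ B

lemma EntriesLE.mono {ρ : G →* Module.End ℤ L} {ι : Type*} {b : Module.Basis ι ℤ L} {B B' : ℕ}
    (h : EntriesLE ρ b B) (hB : B ≤ B') : EntriesLE ρ b B' :=
  fun g i j => (h g i j).trans (by exact_mod_cast hB)

lemma EntriesLE.reindex {ρ : G →* Module.End ℤ L} {ι κ : Type*} {b : Module.Basis ι ℤ L} {B : ℕ}
    (h : EntriesLE ρ b B) (e : ι ≃ κ) : EntriesLE ρ (b.reindex e) B := by
  intro g i j
  simpa using h g (e.symm i) (e.symm j)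

lemma exists_equivariant_retraction [Finite G] (ρ : G →* Module.End ℤ L) (W : Submodule ℤ L)
    (hW : ∀ g, ∀ x ∈ W, ρ g x ∈ W) (p : L →ₗ[ℤ] W) (hp : ∀ w : W, p w = w) :
    ∃ P : L →ₗ[ℤ] W, (∀ w : W, P w = (Nat.card G : ℤ) • w) ∧
      ∀ g x, P (ρ g x) = subRep ρ W hW g (P x) := by
  have := Fintype.ofFinite G
  refine ⟨∑ g : G, (subRep ρ W hW g).comp (p.comp (ρ g⁻¹)), fun w => ?_, fun h x => ?_⟩
  · have h1 : ∀ g : G, (subRep ρ W hW g) (p (ρ g⁻¹ (w : L))) = w := by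
      intro g
      rw [← coe_subRep_apply ρ W hW, hp, ← Module.End.mul_apply, ← map_mul, mul_inv_cancel,
        map_one, Module.End.one_apply]
    simp only [LinearMap.sum_apply, LinearMap.comp_apply, h1]
    simp [Nat.card_eq_fintype_card]
  · simp only [LinearMap.sum_apply, LinearMap.comp_apply, map_sum]
    refine (Fintype.sum_equiv (Equiv.mulLeft h) _ _ fun g => ?_).symm
    simp only [Equiv.coe_mulLeft, mul_inv_rev, map_mul, Module.End.mul_apply]
    congr 3
    rw [← Module.End.mul_apply, ← Module.End.mul_apply, ← map_mul, ← map_mul, mul_assoc]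
    simp

lemma abs_sum_mul_le {k : ℕ} (f g : Fin k → ℤ) {a c : ℤ} (ha : 0 ≤ a) (hf : ∀ i, |f i| ≤ a)
    (hg : ∀ i, |g i| ≤ c) : |∑ i, f i * g i| ≤ k * (a * c) := by
  calc |∑ i, f i * g i| ≤ ∑ i, |f i * g i| := Finset.abs_sum_le_sum_abs _ _
    _ ≤ ∑ _i : Fin k, a * c := by
        refine Finset.sum_le_sum fun i _ => ?_
        rw [abs_mul]
        exact mul_le_mul (hf i) (hg i) (abs_nonneg _) ha
    _ = k * (a * c) := by simp

lemma repr_apply_eq_sum {M : Type*} [AddCommGroup M] {ι : Type*} {k : ℕ}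
    (b : Module.Basis (Fin k) ℤ M) {M' : Type*} [AddCommGroup M'] (b' : Module.Basis ι ℤ M')
    (f : M →ₗ[ℤ] M') (x : M) (i : ι) :
    b'.repr (f x) i = ∑ l, b.repr x l * b'.repr (f (b l)) i := by
  have h : f x = ∑ l, b.repr x l • f (b l) := by
    conv_lhs => rw [← b.sum_repr x, map_sum]
    simp only [map_smul]
  rw [h, map_sum, Finsupp.finsetSum_apply]
  simp only [map_smul, Finsupp.smul_apply, smul_eq_mul]

/-- Bases of an invariant subgroup and of the quotient in which the matrices have small entries
lift to a basis with the same property. -/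
lemma exists_basis_extension [Finite G] (ρ : G →* Module.End ℤ L) (W : Submodule ℤ L)
    (hW : ∀ g, ∀ x ∈ W, ρ g x ∈ W) {k r : ℕ} (w : Module.Basis (Fin k) ℤ W)
    (q : Module.Basis (Fin r) ℤ (L ⧸ W)) {B : ℕ} (hw : EntriesLE (subRep ρ W hW) w B)
    (hq : EntriesLE (quotRep ρ W hW) q B) :
    ∃ b : Module.Basis (Fin k ⊕ Fin r) ℤ L, (∀ i, b (Sum.inl i) ∈ W) ∧
      (∀ x ∈ W, ∀ j, b.repr x (Sum.inr j) = 0) ∧ EntriesLE ρ b ((k + r + 1) * B) := by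
  classical
  set b₀ := Module.Basis.sumQuot w q with hb₀
  set p : L →ₗ[ℤ] W := b₀.constr ℤ (Sum.elim w 0) with hp
  have hpw : ∀ x : W, p x = x := by
    intro x
    suffices h : p.comp W.subtype = LinearMap.id from LinearMap.congr_fun h x
    refine w.ext fun i => ?_
    rw [LinearMap.comp_apply, Submodule.subtype_apply, ← Module.Basis.sumQuot_inl w q i, hp,
      Module.Basis.constr_basis]
    rfl
  obtain ⟨P, hPw, hPρ⟩ := exists_equivariant_retraction ρ W hW p hpw
  set n : ℤ := (Nat.card G : ℤ) with hn
  have hn0 : 0 < n := by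
    rw [hn]
    exact_mod_cast Nat.card_pos
  set ψ : L →ₗ[ℤ] W := b₀.constr ℤ
    (Sum.elim 0 fun j => ∑ i, (w.repr (P (b₀ (Sum.inr j))) i / n) • w i) with hψ
  have hψw : ∀ x : W, ψ x = 0 := by
    intro x
    suffices h : ψ.comp W.subtype = 0 from LinearMap.congr_fun h x
    refine w.ext fun i => ?_
    rw [LinearMap.comp_apply, Submodule.subtype_apply, ← Module.Basis.sumQuot_inl w q i, hψ,
      Module.Basis.constr_basis]
    rfl
  let T : L ≃ₗ[ℤ] L := LinearEquiv.ofLinearMap (LinearMap.id - W.subtype.comp ψ)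
    (LinearMap.id + W.subtype.comp ψ)
    (by ext x; simp [hψw]) (by ext x; simp [hψw])
  have hT : ∀ x, T x = x - (ψ x : L) := fun x => rfl
  have hTs : ∀ x, T.symm x = x + (ψ x : L) := fun x => rfl
  set b := b₀.map T with hb
  have hbl : ∀ i, b (Sum.inl i) = w i := by
    intro i
    rw [hb, Module.Basis.map_apply, hT, hb₀, Module.Basis.sumQuot_inl, hψw]
    simp
  have hbr : ∀ j, W.mkQ (b (Sum.inr j)) = q j := by
    intro j
    rw [hb, Module.Basis.map_apply, hT, map_sub, W.mkQ_apply, hb₀, Module.Basis.sumQuot_inr,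
      W.mkQ_apply, (Submodule.Quotient.mk_eq_zero W).2 (ψ _).2, sub_zero]
  have hrepr : ∀ x, b.repr x = b₀.repr (x + (ψ x : L)) := fun x => rfl
  have hreprr : ∀ x j, b.repr x (Sum.inr j) = q.repr (W.mkQ x) j := by
    intro x j
    rw [hrepr, hb₀, Module.Basis.sumQuot_repr_inr, map_add, W.mkQ_apply (ψ x : L),
      (Submodule.Quotient.mk_eq_zero W).2 (ψ x).2, add_zero]
  have hreprl : ∀ (x : W) i, b.repr x (Sum.inl i) = w.repr x i := by
    intro x i
    rw [hrepr, hψw, Submodule.coe_zero, add_zero, hb₀, Module.Basis.sumQuot_repr_inl]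
  have hreprW : ∀ x ∈ W, ∀ j, b.repr x (Sum.inr j) = 0 := by
    intro x hx j
    rw [hreprr, W.mkQ_apply, (Submodule.Quotient.mk_eq_zero W).2 hx, map_zero]
    rfl
  have hPb : ∀ j i, |w.repr (P (b (Sum.inr j))) i| ≤ n := by
    intro j i
    have h1 : w.repr (P (b (Sum.inr j))) i = w.repr (P (b₀ (Sum.inr j))) i % n := by
      rw [hb, Module.Basis.map_apply, hT, map_sub, hPw, hψ, Module.Basis.constr_basis,
        Sum.elim_inr, map_sub, map_smul, Finsupp.sub_apply, Finsupp.smul_apply, w.repr_sum_self,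
        smul_eq_mul, Int.emod_def]
    rw [h1]
    exact (abs_emod_le _ _ hn0.ne').trans (abs_of_pos hn0).le
  have hBle : B ≤ (k + r + 1) * B := Nat.le_mul_of_pos_left _ (by omega)
  refine ⟨b, fun i => by rw [hbl]; exact (w i).2, hreprW, ?_⟩
  rintro g (i | i) (j | j)
  · rw [hbl, ← coe_subRep_apply ρ W hW, hreprl]
    exact hw.mono hBle g i j
  · set y := ρ g (b (Sum.inr j)) with hy
    have h1 : w.repr (P y) i = ∑ l, w.repr (P (b (Sum.inr j))) l * w.repr (subRep ρ W hW g (w l)) i := by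
      rw [hy, hPρ, repr_apply_eq_sum w w]
    have h2 : w.repr (P y) i = n * b.repr y (Sum.inl i) +
        ∑ l, b.repr y (Sum.inr l) * w.repr (P (b (Sum.inr l))) i := by
      have h3 : P y = ∑ l, b.repr y (Sum.inl l) • (n • w l) +
          ∑ l, b.repr y (Sum.inr l) • P (b (Sum.inr l)) := by
        conv_lhs => rw [← b.sum_repr y, Fintype.sum_sum_type, map_add, map_sum, map_sum]
        congr 1
        · refine Finset.sum_congr rfl fun l _ => ?_
          rw [map_smul, hbl, hPw]
        · refine Finset.sum_congr rfl fun l _ => ?_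
          rw [map_smul]
      rw [h3, map_add, Finsupp.add_apply]
      congr 1
      · simp only [smul_smul]
        rw [w.repr_sum_self, mul_comm]
      · simp [Finsupp.finsetSum_apply]
    have h4 := abs_sum_mul_le _ _ hn0.le (hPb j) (fun l => hw g i l)
    have h5 : |∑ l, b.repr y (Sum.inr l) * w.repr (P (b (Sum.inr l))) i| ≤ r * ((B : ℤ) * n) := by
      refine abs_sum_mul_le _ _ (by positivity) (fun l => ?_) (fun l => hPb l i)
      rw [hreprr, hy, ← quotRep_mkQ ρ W hW, hbr]
      exact hq g l j
    rw [← h1, h2] at h4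
    have h6 : n * |b.repr y (Sum.inl i)| ≤ n * (k * B + r * B) := by
      rw [← abs_of_pos hn0, ← abs_mul, abs_of_pos hn0]
      calc |n * b.repr y (Sum.inl i)| = |(n * b.repr y (Sum.inl i) +
              ∑ l, b.repr y (Sum.inr l) * w.repr (P (b (Sum.inr l))) i) -
              ∑ l, b.repr y (Sum.inr l) * w.repr (P (b (Sum.inr l))) i| := by rw [add_sub_cancel_right]
        _ ≤ k * (n * B) + r * (B * n) := (abs_sub _ _).trans (add_le_add h4 h5)
        _ = n * (k * B + r * B) := by ring
    refine (le_of_mul_le_mul_left h6 hn0).trans ?_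
    push_cast
    nlinarith
  · rw [hreprW _ (hW g _ (by rw [hbl]; exact (w j).2)), abs_zero]
    positivity
  · rw [hreprr, ← quotRep_mkQ ρ W hW, hbr]
    exact hq.mono hBle g i j

/-- The invariant seminorm obtained by summing coordinates over the group. -/
def sumNorm [Fintype G] (ρ : G →* Module.End ℤ L) {k : ℕ} (b : Module.Basis (Fin k) ℤ L) (x : L) :
    ℤ := ∑ g, ∑ i, |b.repr (ρ g x) i|

lemma isIntSeminorm_sumNorm [Fintype G] (ρ : G →* Module.End ℤ L) {k : ℕ}
    (b : Module.Basis (Fin k) ℤ L) : IsIntSeminorm (sumNorm ρ b) where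
  add_le x y := by
    simp only [sumNorm, map_add, Finsupp.add_apply, ← Finset.sum_add_distrib]
    exact Finset.sum_le_sum fun g _ => Finset.sum_le_sum fun i _ => abs_add_le _ _
  smul_eq c x := by
    simp only [sumNorm, map_smul, Finsupp.smul_apply, smul_eq_mul, abs_mul, Finset.mul_sum]

lemma sumNorm_map [Fintype G] (ρ : G →* Module.End ℤ L) {k : ℕ} (b : Module.Basis (Fin k) ℤ L)
    (g : G) (x : L) : sumNorm ρ b (ρ g x) = sumNorm ρ b x := by
  refine Fintype.sum_equiv (Equiv.mulRight g) _ _ fun h => ?_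
  simp [map_mul]

lemma sumNorm_pos [Fintype G] (ρ : G →* Module.End ℤ L) {k : ℕ} (b : Module.Basis (Fin k) ℤ L)
    {x : L} (hx : x ≠ 0) : 0 < sumNorm ρ b x := by
  have hne : b.repr x ≠ 0 := by simpa using hx
  obtain ⟨i, hi⟩ := Finsupp.ne_iff.1 hne
  have h1 : 0 < ∑ i, |b.repr (ρ 1 x) i| := by
    refine Finset.sum_pos' (fun i _ => abs_nonneg _) ⟨i, Finset.mem_univ _, ?_⟩
    rw [map_one]
    exact abs_pos.2 hi
  exact Finset.sum_pos' (fun g _ => Finset.sum_nonneg fun i _ => abs_nonneg _)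
    ⟨1, Finset.mem_univ _, h1⟩

/-- A nonzero integral representation has a nonzero saturated invariant subgroup with a basis
in which the matrices have entries bounded in terms of the rank. -/
lemma exists_invariant_basis [Finite G] [Module.Finite ℤ L] [Module.Free ℤ L] [Nontrivial L]
    (ρ : G →* Module.End ℤ L) {n : ℕ} (hn : Module.finrank ℤ L ≤ n) :
    ∃ (W : Submodule ℤ L) (hW : ∀ g, ∀ x ∈ W, ρ g x ∈ W) (k : ℕ)
      (w : Module.Basis (Fin k) ℤ W), W ≠ ⊥ ∧ IsSaturated W ∧ k ≤ n ∧
      EntriesLE (subRep ρ W hW) w ((2 * basisConst n * (n + 1) + 1) ^ n) := by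
  have := Fintype.ofFinite G
  set N := sumNorm ρ (Module.finBasis ℤ L) with hNdef
  have hN : IsIntSeminorm N := isIntSeminorm_sumNorm ρ _
  obtain ⟨v, hv0, hvmin⟩ : ∃ v : L, v ≠ 0 ∧ ∀ x, x ≠ 0 → N v ≤ N x := by
    obtain ⟨x₀, hx₀⟩ := exists_ne (0 : L)
    obtain ⟨v, hv, hmin⟩ := (measure fun x : L => (N x).toNat).wf.has_min {x | x ≠ 0} ⟨x₀, hx₀⟩
    refine ⟨v, hv, fun x hx => ?_⟩
    have h1 := hmin x hx
    have h2 := hN.nonneg x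
    have h3 : ¬ (N x).toNat < (N v).toNat := h1
    omega
  set lam := N v with hlam
  have hlam0 : 0 < lam := sumNorm_pos ρ _ hv0
  set S : Set L := Set.range fun g => ρ g v with hS
  have hSN : ∀ s ∈ S, N s ≤ lam := by
    rintro _ ⟨g, rfl⟩
    exact (sumNorm_map ρ _ g v).le
  have hspan : ∀ g, ∀ x ∈ Submodule.span ℤ S, ρ g x ∈ Submodule.span ℤ S := by
    intro g x hx
    refine (Submodule.span_le (p := (Submodule.span ℤ S).comap (ρ g))).2 ?_ hx
    rintro _ ⟨h, rfl⟩
    refine Submodule.subset_span ⟨g * h, ?_⟩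
    simp [map_mul]
  have hW : ∀ g, ∀ x ∈ saturation (Submodule.span ℤ S), ρ g x ∈ saturation (Submodule.span ℤ S) := by
    rintro g x ⟨c, hc, hx⟩
    exact ⟨c, hc, by rw [← map_smul]; exact hspan g _ hx⟩
  obtain ⟨k, hk, w, hw⟩ := exists_short_basis hN hlam0.le S hSN
  have hw' : ∀ i, N (w i) ≤ basisConst n * lam := fun i => (hw i).trans
    (mul_le_mul_of_nonneg_right (by exact_mod_cast basisConst_mono hn) hlam0.le)
  refine ⟨_, hW, k, w, ?_, isSaturated_saturation _, hk.trans hn, ?_⟩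
  · intro h
    have h1 : v ∈ saturation (Submodule.span ℤ S) :=
      le_saturation _ (Submodule.subset_span ⟨1, by simp⟩)
    rw [h, Submodule.mem_bot] at h1
    exact hv0 h1
  · intro g i j
    refine (abs_repr_le_of_short (hN.comp (Submodule.subtype _)) w hlam0 (fun x hx => ?_)
      (basisConst n) hw' ?_ i).trans ?_
    · exact hvmin _ (by simpa using hx)
    · refine le_of_eq_of_le ?_ (hw' j)
      exact sumNorm_map ρ _ g _
    · have hkn := hk.trans hn
      have h1 : (2 * basisConst n * (k + 1) + 1) ^ k ≤ (2 * basisConst n * (n + 1) + 1) ^ n :=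
        (Nat.pow_le_pow_left (by gcongr) k).trans (Nat.pow_le_pow_right (by omega) hkn)
      exact_mod_cast h1

/-- **Jordan–Zassenhaus**: a representation of a finite group on a free abelian group of rank
at most `n` has integral matrices with entries bounded in terms of `n` in a suitable basis. -/
theorem exists_basis_entriesLE (n : ℕ) : ∃ B : ℕ, ∀ (G : Type) [Group G] [Finite G] (L : Type)
    [AddCommGroup L] [Module.Finite ℤ L] [Module.Free ℤ L] (ρ : G →* Module.End ℤ L),
    Module.finrank ℤ L ≤ n →
    ∃ (k : ℕ) (b : Module.Basis (Fin k) ℤ L), k ≤ n ∧ EntriesLE ρ b B := by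
  induction n with
  | zero =>
    refine ⟨0, fun G _ _ L _ _ _ ρ h => ⟨_, Module.finBasis ℤ L, h, fun g i j => ?_⟩⟩
    exact absurd i.2 (by omega)
  | succ n ih =>
    obtain ⟨B, hB⟩ := ih
    set B₁ := (2 * basisConst (n + 1) * (n + 1 + 1) + 1) ^ (n + 1) with hB₁
    refine ⟨(2 * n + 2) * max B B₁, fun G _ _ L _ _ _ ρ h => ?_⟩
    rcases subsingleton_or_nontrivial L with hL | hL
    · refine ⟨0, Module.Basis.empty L, Nat.zero_le _, fun g i => i.elim0⟩
    obtain ⟨W, hW, k, w, hW0, hWs, hk, hw⟩ := exists_invariant_basis ρ h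
    have := hWs.free
    have hrank : Module.finrank ℤ (L ⧸ W) + Module.finrank ℤ W = Module.finrank ℤ L :=
      Submodule.finrank_quotient_add_finrank W
    have hpos : 0 < Module.finrank ℤ W := by
      have : Nontrivial W := Submodule.nontrivial_iff_ne_bot.2 hW0
      exact Module.finrank_pos
    obtain ⟨r, q, hr, hq⟩ := hB G (L ⧸ W) (quotRep ρ W hW) (by omega)
    obtain ⟨b, -, -, hb⟩ := exists_basis_extension ρ W hW w q (hw.mono (le_max_right B B₁))
      (hq.mono (le_max_left B B₁))
    have hcard := Module.finrank_eq_card_basis b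
    rw [Fintype.card_sum, Fintype.card_fin, Fintype.card_fin] at hcard
    refine ⟨k + r, b.reindex finSumFinEquiv, by omega, ?_⟩
    refine (hb.reindex finSumFinEquiv).mono (Nat.mul_le_mul_right _ ?_)
    omega

/-- The relative form of the Jordan–Zassenhaus theorem, for a representation with a saturated
invariant subgroup. -/
theorem exists_adapted_basis (n : ℕ) : ∃ B : ℕ, ∀ (G : Type) [Group G] [Finite G] (L : Type)
    [AddCommGroup L] [Module.Finite ℤ L] [Module.Free ℤ L] (ρ : G →* Module.End ℤ L)
    (W : Submodule ℤ L), IsSaturated W → (∀ g, ∀ x ∈ W, ρ g x ∈ W) → Module.finrank ℤ L = n →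
    ∃ (b : Module.Basis (Fin n) ℤ L) (J : Set (Fin n)), (∀ j ∈ J, b j ∈ W) ∧
      (∀ x ∈ W, ∀ j ∉ J, b.repr x j = 0) ∧ EntriesLE ρ b B := by
  obtain ⟨B, hB⟩ := exists_basis_entriesLE n
  refine ⟨(n + 1) * B, fun G _ _ L _ _ _ ρ W hWs hW h => ?_⟩
  have := hWs.free
  have hrank : Module.finrank ℤ (L ⧸ W) + Module.finrank ℤ W = Module.finrank ℤ L :=
    Submodule.finrank_quotient_add_finrank W
  obtain ⟨k, w, -, hw⟩ := hB G W (subRep ρ W hW) (by omega)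
  obtain ⟨r, q, -, hq⟩ := hB G (L ⧸ W) (quotRep ρ W hW) (by omega)
  obtain ⟨b, hbW, hWb, hb⟩ := exists_basis_extension ρ W hW w q hw hq
  have hcard := Module.finrank_eq_card_basis b
  rw [Fintype.card_sum, Fintype.card_fin, Fintype.card_fin, h] at hcard
  subst hcard
  refine ⟨b.reindex finSumFinEquiv, Set.range (finSumFinEquiv ∘ Sum.inl), ?_, ?_,
    hb.reindex _⟩
  · rintro _ ⟨i, rfl⟩
    simpa using hbW i
  · intro x hx j hj
    obtain ⟨j, rfl⟩ := finSumFinEquiv.surjective j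
    rcases j with j | j
    · exact absurd ⟨j, rfl⟩ hj
    · simpa using hWb x hx j

end IntegralRepresentation

section SpaceGroup

variable {X : Type*} [NormedAddCommGroup X] [InnerProductSpace ℝ X]

/-- The linear part of an isometry, as a homomorphism. -/
def linHom (X : Type*) [NormedAddCommGroup X] [InnerProductSpace ℝ X] :
    (X ≃ᵢ X) →* (X ≃ₗᵢ[ℝ] X) where
  toFun φ := φ.toRealLinearIsometryEquiv
  map_one' := by
    ext x
    simp
  map_mul' φ ψ := by
    ext x
    have h (y z : X) : φ y - φ z = φ.toRealLinearIsometryEquiv (y - z) := by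
      rw [map_sub]
      simp
    simp only [LinearIsometryEquiv.coe_mul, Function.comp_apply,
      IsometryEquiv.toRealLinearIsometryEquiv_apply ψ, ← h]
    simp

lemma linHom_apply (φ : X ≃ᵢ X) (x : X) : linHom X φ x = φ x - φ 0 :=
  IsometryEquiv.toRealLinearIsometryEquiv_apply φ x

lemma isometry_eq_add_linHom (φ : X ≃ᵢ X) (x : X) : φ x = φ 0 + linHom X φ x := by
  rw [linHom_apply]
  abel

lemma isometry_add (φ : X ≃ᵢ X) (x y : X) : φ (x + y) = φ x + linHom X φ y := by
  rw [isometry_eq_add_linHom φ (x + y), map_add, ← add_assoc, ← isometry_eq_add_linHom]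

lemma linHom_transIso (a : X) : linHom X (transIso a) = 1 := by
  ext x
  simp [linHom_apply]

lemma eq_transIso_of_linHom_eq_one {φ : X ≃ᵢ X} (h : linHom X φ = 1) : φ = transIso (φ 0) := by
  ext x
  rw [isometry_eq_add_linHom, h]
  rfl

lemma linHom_inv_apply (φ : X ≃ᵢ X) (x : X) : linHom X φ (linHom X φ⁻¹ x) = x := by
  have h : (linHom X φ * linHom X φ⁻¹) x = x := by
    rw [← map_mul, mul_inv_cancel, map_one]
    rfl
  exact h

/-- An element of the orthogonal group is within `c` of the identity in operator norm. -/
def RotLE (A : X ≃ₗᵢ[ℝ] X) (c : ℝ) : Prop := ∀ x, ‖A x - x‖ ≤ c * ‖x‖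

lemma RotLE.mono {A : X ≃ₗᵢ[ℝ] X} {c d : ℝ} (h : RotLE A c) (hcd : c ≤ d) : RotLE A d :=
  fun x => (h x).trans (mul_le_mul_of_nonneg_right hcd (norm_nonneg x))

/-- The subspace on which a nontrivial orthogonal map rotates most, with a spectral gap on its
orthogonal complement. -/
lemma exists_max_rotation_subspace [FiniteDimensional ℝ X] {A : X ≃ₗᵢ[ℝ] X} (hA : A ≠ 1) :
    ∃ (U : Submodule ℝ X) (m m' : ℝ), U ≠ ⊥ ∧ 0 ≤ m' ∧ m' < m ∧ (∀ x ∈ U, A x ∈ U) ∧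
      (∀ x ∈ Uᗮ, A x ∈ Uᗮ) ∧ (∀ x ∈ U, ‖A x - x‖ = m * ‖x‖) ∧
      ∀ x ∈ Uᗮ, ‖A x - x‖ ≤ m' * ‖x‖ := by
  classical
  let S : X →ₗ[ℝ] X := (2 : ℝ) • LinearMap.id - A.toLinearEquiv.toLinearMap -
    A.symm.toLinearEquiv.toLinearMap
  have hSapply : ∀ x, S x = (2 : ℝ) • x - A x - A.symm x := fun x => rfl
  have hflip : ∀ x y, inner ℝ (A x) y = inner ℝ x (A.symm y) := fun x y => by
    rw [← A.inner_map_map x, A.apply_symm_apply]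
  have hflip' : ∀ x y, inner ℝ (A.symm x) y = inner ℝ x (A y) := fun x y => by
    rw [← A.inner_map_map _ y, A.apply_symm_apply]
  have hS : S.IsSymmetric := by
    intro x y
    rw [hSapply, hSapply, inner_sub_left, inner_sub_left, inner_sub_right, inner_sub_right,
      hflip, hflip', inner_smul_left, inner_smul_right]
    simp only [RCLike.conj_to_real]
    ring
  have hnorm : ∀ x, ‖A x - x‖ ^ 2 = inner ℝ (S x) x := by
    intro x
    rw [hSapply, inner_sub_left, inner_sub_left, inner_smul_left, norm_sub_sq_real, A.norm_map,
      hflip', real_inner_self_eq_norm_sq, real_inner_comm x (A x)]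
    simp only [RCLike.conj_to_real]
    ring
  set n := Module.finrank ℝ X with hn
  set e := hS.eigenvectorBasis rfl with he
  set lam := hS.eigenvalues rfl with hlam
  have hSe : ∀ i, S (e i) = lam i • e i := fun i => hS.apply_eigenvectorBasis rfl i
  have hexp : ∀ x, inner ℝ (S x) x = ∑ i, lam i * inner ℝ (e i) x ^ 2 := by
    intro x
    rw [← e.sum_inner_mul_inner (S x) x]
    refine Finset.sum_congr rfl fun i _ => ?_
    rw [hS, hSe, inner_smul_right, real_inner_comm x (e i)]
    ring
  have hnormsq : ∀ x, ‖x‖ ^ 2 = ∑ i, inner ℝ (e i) x ^ 2 := by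
    intro x
    rw [← real_inner_self_eq_norm_sq, ← e.sum_inner_mul_inner x x]
    refine Finset.sum_congr rfl fun i _ => ?_
    rw [real_inner_comm x (e i)]
    ring
  obtain ⟨x₀, hx₀⟩ : ∃ x, A x ≠ x := by
    by_contra! h
    exact hA (by ext x; exact h x)
  have hpos : 0 < inner ℝ (S x₀) x₀ := by
    rw [← hnorm]
    have : 0 < ‖A x₀ - x₀‖ := norm_pos_iff.2 (sub_ne_zero.2 hx₀)
    positivity
  have hne : Nonempty (Fin (Module.finrank ℝ X)) := by
    by_contra hemp
    rw [not_nonempty_iff] at hemp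
    rw [hexp, Finset.univ_eq_empty, Finset.sum_empty] at hpos
    exact lt_irrefl _ hpos
  obtain ⟨i₀, hi₀⟩ := Finite.exists_max lam
  have hmu : 0 < lam i₀ := by
    by_contra! hle
    have : inner ℝ (S x₀) x₀ ≤ 0 := by
      rw [hexp]
      exact Finset.sum_nonpos fun i _ =>
        mul_nonpos_of_nonpos_of_nonneg ((hi₀ i).trans hle) (sq_nonneg _)
    linarith
  obtain ⟨mu', hmu'0, hmu'lt, hmu'⟩ : ∃ mu' : ℝ, 0 ≤ mu' ∧ mu' < lam i₀ ∧
      ∀ i, lam i ≠ lam i₀ → lam i ≤ mu' := by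
    set F : Finset ℝ := insert 0 ((Finset.univ.image lam).filter (· ≠ lam i₀)) with hF
    have hFne : F.Nonempty := Finset.insert_nonempty _ _
    refine ⟨F.max' hFne, Finset.le_max' _ _ (Finset.mem_insert_self _ _), ?_, fun i hi => ?_⟩
    · rw [Finset.max'_lt_iff]
      intro y hy
      rcases Finset.mem_insert.1 hy with rfl | hy
      · exact hmu
      · obtain ⟨hy1, hy2⟩ := Finset.mem_filter.1 hy
        obtain ⟨i, -, rfl⟩ := Finset.mem_image.1 hy1
        exact lt_of_le_of_ne (hi₀ i) hy2
    · have hmem : lam i ∈ F := Finset.mem_insert_of_mem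
        (Finset.mem_filter.2 ⟨Finset.mem_image_of_mem _ (Finset.mem_univ i), hi⟩)
      exact Finset.le_max' _ _ hmem
  set U := Module.End.eigenspace S (lam i₀) with hU
  have hmemU : ∀ x, x ∈ U ↔ S x = lam i₀ • x := fun x => Module.End.mem_eigenspace_iff
  have hAU : ∀ x ∈ U, A x ∈ U := by
    intro x hx
    rw [hmemU] at hx ⊢
    have h1 : S (A x) = A (S x) := by
      rw [hSapply, hSapply, map_sub, map_sub, map_smul, A.symm_apply_apply, A.apply_symm_apply]
    rw [h1, hx, map_smul]
  have hAsU : ∀ x ∈ U, A.symm x ∈ U := by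
    intro x hx
    rw [hmemU] at hx ⊢
    have h1 : S (A.symm x) = A.symm (S x) := by
      rw [hSapply, hSapply, map_sub, map_sub, map_smul, A.symm_apply_apply, A.apply_symm_apply]
    rw [h1, hx, map_smul]
  refine ⟨U, √(lam i₀), √mu', ?_, Real.sqrt_nonneg _, Real.sqrt_lt_sqrt hmu'0 hmu'lt, hAU,
    ?_, ?_, ?_⟩
  · intro h
    have h1 : e i₀ ∈ U := (hmemU _).2 (hSe i₀)
    rw [h, Submodule.mem_bot] at h1
    exact e.orthonormal.ne_zero i₀ h1
  · intro x hx
    rw [Submodule.mem_orthogonal'] at hx ⊢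
    intro y hy
    rw [hflip]
    exact hx _ (hAsU y hy)
  · intro x hx
    refine (sq_eq_sq₀ (norm_nonneg _) (by positivity)).1 ?_
    rw [hnorm, (hmemU x).1 hx, inner_smul_left, real_inner_self_eq_norm_sq, mul_pow,
      Real.sq_sqrt hmu.le]
    rfl
  · intro x hx
    refine (sq_le_sq₀ (norm_nonneg _) (by positivity)).1 ?_
    rw [hnorm, hexp, mul_pow, Real.sq_sqrt hmu'0, hnormsq, Finset.mul_sum]
    refine Finset.sum_le_sum fun i _ => ?_
    by_cases hi : lam i = lam i₀
    · have h1 : e i ∈ U := by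
        rw [hmemU, ← hi]
        exact hSe i
      rw [(Submodule.mem_orthogonal U x).1 hx _ h1]
      simp
    · exact mul_le_mul_of_nonneg_right (hmu' i hi) (sq_nonneg _)

/-- A space group contains elements with arbitrarily small rotational part and long
translational part in any given direction. -/
lemma IsSpaceGroup.exists_small_rotation [FiniteDimensional ℝ X] {Γ : Subgroup (X ≃ᵢ X)}
    (hΓ : IsSpaceGroup Γ) (u : X) {ε : ℝ} (hε : 0 < ε) :
    ∃ c : ℝ, ∀ R : ℝ, ∃ t ≥ R, ∃ β ∈ Γ, RotLE (linHom X β) ε ∧ ‖β 0 - t • u‖ ≤ c := by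
  obtain ⟨-, K, hK, hcov⟩ := hΓ
  obtain ⟨d, hd⟩ := hK.isBounded.subset_closedBall 0
  have hex : ∀ k : ℕ, ∃ γ ∈ Γ, ‖γ 0 - (k : ℝ) • u‖ ≤ d := by
    intro k
    obtain ⟨γ, hγ, hγK⟩ := hcov ((k : ℝ) • u)
    refine ⟨γ⁻¹, inv_mem hγ, ?_⟩
    rw [← dist_eq_norm, ← γ.dist_eq, IsometryEquiv.apply_inv_self, dist_comm]
    exact hd hγK
  choose γ hγ hγd using hex
  let B : ℕ → (X →L[ℝ] X) := fun k => (linHom X (γ k)).toContinuousLinearEquiv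
  have hB : ∀ k x, B k x = linHom X (γ k) x := fun k x => rfl
  obtain ⟨B₀, -, φ, hφ, hlim⟩ := tendsto_subseq_of_bounded (x := B)
    (Metric.isBounded_closedBall (x := (0 : X →L[ℝ] X)) (r := 1)) (fun k => by
      rw [mem_closedBall_zero_iff]
      exact ContinuousLinearMap.opNorm_le_bound _ zero_le_one fun x => by simp [hB])
  obtain ⟨i, hi⟩ := Metric.cauchySeq_iff'.1 hlim.cauchySeq ε hε
  refine ⟨d + ‖(γ (φ i))⁻¹ 0‖, fun R => ?_⟩
  obtain ⟨j₀, hj₀⟩ := exists_nat_ge R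
  set j := max j₀ i with hj
  refine ⟨(φ j : ℝ), hj₀.trans ?_, γ (φ j) * (γ (φ i))⁻¹, mul_mem (hγ _) (inv_mem (hγ _)), ?_, ?_⟩
  · exact_mod_cast (le_max_left j₀ i).trans hφ.le_apply
  · intro x
    set y := linHom X (γ (φ i))⁻¹ x with hy
    have hyx : linHom X (γ (φ i)) y = x := linHom_inv_apply _ x
    have h1 : linHom X (γ (φ j) * (γ (φ i))⁻¹) x - x = (B (φ j) - B (φ i)) y := by
      rw [map_mul, sub_apply, hB, hB, hyx]
      rfl
    rw [h1]
    have h2 : ‖B (φ j) - B (φ i)‖ ≤ ε := by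
      rw [← dist_eq_norm]
      exact (hi j (le_max_right _ _)).le
    refine ((B (φ j) - B (φ i)).le_opNorm y).trans ?_
    rw [hy, LinearIsometryEquiv.norm_map]
    exact mul_le_mul_of_nonneg_right h2 (norm_nonneg _)
  · have h1 : (γ (φ j) * (γ (φ i))⁻¹) 0 - (φ j : ℝ) • u =
        (γ (φ j) 0 - (φ j : ℝ) • u) + linHom X (γ (φ j)) ((γ (φ i))⁻¹ 0) := by
      rw [IsometryEquiv.mul_apply, isometry_eq_add_linHom (γ (φ j)) ((γ (φ i))⁻¹ 0)]
      abel
    rw [h1]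
    refine (norm_add_le _ _).trans (add_le_add (hγd _) ?_)
    rw [LinearIsometryEquiv.norm_map]

lemma IsSpaceGroup.finite_short [FiniteDimensional ℝ X] {Γ : Subgroup (X ≃ᵢ X)}
    (hΓ : IsSpaceGroup Γ) (R : ℝ) : {γ : X ≃ᵢ X | γ ∈ Γ ∧ ‖γ 0‖ ≤ R}.Finite := by
  refine (hΓ.1 _ (isCompact_closedBall (0 : X) R)).subset ?_
  rintro γ ⟨hγ, hR⟩
  refine ⟨hγ, γ 0, ⟨0, ?_, rfl⟩, by simpa using hR⟩
  simpa using (norm_nonneg _).trans hR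

lemma IsSpaceGroup.exists_shortest [FiniteDimensional ℝ X] {Γ : Subgroup (X ≃ᵢ X)}
    (hΓ : IsSpaceGroup Γ) {p : (X ≃ᵢ X) → Prop} (hp : ∃ γ ∈ Γ, p γ) :
    ∃ γ ∈ Γ, p γ ∧ ∀ δ ∈ Γ, p δ → ‖γ 0‖ ≤ ‖δ 0‖ := by
  obtain ⟨γ₀, hγ₀, hpγ₀⟩ := hp
  have hfin : {γ : X ≃ᵢ X | (γ ∈ Γ ∧ ‖γ 0‖ ≤ ‖γ₀ 0‖) ∧ p γ}.Finite :=
    (hΓ.finite_short ‖γ₀ 0‖).subset fun γ h => h.1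
  obtain ⟨γ, ⟨⟨hγ, hle⟩, hpγ⟩, hmin⟩ :=
    Set.exists_min_image _ (fun γ : X ≃ᵢ X => ‖γ 0‖) hfin ⟨γ₀, ⟨hγ₀, le_rfl⟩, hpγ₀⟩
  refine ⟨γ, hγ, hpγ, fun δ hδ hpδ => ?_⟩
  by_cases h : ‖δ 0‖ ≤ ‖γ₀ 0‖
  · exact hmin δ ⟨⟨hδ, h⟩, hpδ⟩
  · exact hle.trans (not_le.1 h).le

lemma RotLE.commutator {A B : X ≃ₗᵢ[ℝ] X} {c d : ℝ} (hc : 0 ≤ c) (hd : 0 ≤ d) (hA : RotLE A c)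
    (hB : RotLE B d) : RotLE (A * B * A⁻¹ * B⁻¹) (2 * c * d) := by
  intro x
  set y := A⁻¹ (B⁻¹ x) with hy
  have hx : x = B (A y) := by
    have h1 : A y = B⁻¹ x := A.apply_symm_apply _
    have h2 : B (B⁻¹ x) = x := B.apply_symm_apply _
    rw [h1, h2]
  have hyn : ‖x‖ = ‖y‖ := by rw [hx, B.norm_map, A.norm_map]
  have h1 : (A * B * A⁻¹ * B⁻¹) x = A (B y) := rfl
  have h2 : A (B y) - B (A y) = (A (B y - y) - (B y - y)) - (B (A y - y) - (A y - y)) := by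
    rw [map_sub, map_sub]
    abel
  rw [h1, hyn]
  conv_lhs => rw [hx]
  rw [h2]
  have h3 : ‖A (B y - y) - (B y - y)‖ ≤ c * (d * ‖y‖) :=
    (hA _).trans (mul_le_mul_of_nonneg_left (hB y) hc)
  have h4 : ‖B (A y - y) - (A y - y)‖ ≤ d * (c * ‖y‖) :=
    (hB _).trans (mul_le_mul_of_nonneg_left (hA y) hd)
  refine (norm_sub_le _ _).trans ?_
  linarith

lemma norm_commutator_sub_le {α β : X ≃ᵢ X} {ε : ℝ} (hε : 0 ≤ ε)
    (hα : RotLE (linHom X α) (1 / 2)) (hβ : RotLE (linHom X β) ε)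
    (h : linHom X β = 1 ∨ ‖α 0‖ ≤ ‖β 0‖) :
    ‖(α * β * α⁻¹ * β⁻¹) 0 - (linHom X α (β 0) - β 0)‖ ≤ 2 * ε * ‖β 0‖ := by
  set A := linHom X α with hAdef
  set B := linHom X β with hBdef
  set C := linHom X (α * β * α⁻¹ * β⁻¹) with hC
  have hCeq : C = A * B * A⁻¹ * B⁻¹ := by rw [hC]; simp only [map_mul, map_inv]; rfl
  have hCB : ∀ x, C (B x) = A (B (A⁻¹ x)) := by
    intro x
    have h1 : B⁻¹ (B x) = x := B.symm_apply_apply x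
    rw [hCeq]
    change A (B (A⁻¹ (B⁻¹ (B x)))) = _
    rw [h1]
  have h1 : (α * β * α⁻¹ * β⁻¹) (β (α 0)) = α (β 0) := by
    simp [IsometryEquiv.mul_apply]
  have h2 : (α * β * α⁻¹ * β⁻¹) 0 - (A (β 0) - β 0) =
      (β 0 - C (β 0)) + (α 0 - A (B (A⁻¹ (α 0)))) := by
    rw [isometry_eq_add_linHom (α * β * α⁻¹ * β⁻¹), isometry_eq_add_linHom β (α 0),
      isometry_eq_add_linHom α (β 0), map_add] at h1
    rw [← hCB, eq_sub_of_add_eq h1]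
    abel
  rw [h2]
  rcases h with h | h
  · have hC1 : C = 1 := by rw [hCeq, h]; simp
    have hA1 : A (A⁻¹ (α 0)) = α 0 := A.apply_symm_apply _
    rw [hC1, h]
    simp only [LinearIsometryEquiv.coe_one, id_eq, hA1, sub_self, add_zero, norm_zero]
    positivity
  · have h3 : ‖β 0 - C (β 0)‖ ≤ ε * ‖β 0‖ := by
      rw [norm_sub_rev, hCeq]
      have := hα.commutator (by norm_num) hε hβ (β 0)
      linarith
    have h4 : ‖α 0 - A (B (A⁻¹ (α 0)))‖ ≤ ε * ‖α 0‖ := by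
      set y := A⁻¹ (α 0) with hy
      have hAy : A y = α 0 := A.apply_symm_apply _
      rw [norm_sub_rev, ← hAy, ← map_sub, A.norm_map, A.norm_map]
      exact hβ y
    have h5 := mul_le_mul_of_nonneg_left h hε
    refine (norm_add_le _ _).trans ?_
    linarith

/-- Elements of a space group with small rotational part are translations. -/
lemma IsSpaceGroup.linHom_eq_one [FiniteDimensional ℝ X] {Γ : Subgroup (X ≃ᵢ X)}
    (hΓ : IsSpaceGroup Γ) {γ : X ≃ᵢ X} (hγ : γ ∈ Γ) (hrot : RotLE (linHom X γ) (1 / 2)) :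
    linHom X γ = 1 := by
  by_contra hne
  obtain ⟨α, hα, ⟨hαrot, hαne⟩, hαmin⟩ := hΓ.exists_shortest
    (p := fun γ => RotLE (linHom X γ) (1 / 2) ∧ linHom X γ ≠ 1) ⟨γ, hγ, hrot, hne⟩
  obtain ⟨U, m, m', hU, hm'0, hm', hAU, hAU', hmU, hmU'⟩ := exists_max_rotation_subspace hαne
  set A := linHom X α with hA
  obtain ⟨u, huU, hu0⟩ := U.exists_mem_ne_zero_of_ne_bot hU
  have hun : 0 < ‖u‖ := norm_pos_iff.2 hu0
  have hm : m ≤ 1 / 2 := by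
    have h1 := hαrot u
    rw [hmU u huU] at h1
    exact le_of_mul_le_mul_right h1 hun
  set ε := (m - m') / 8 with hε
  have hεpos : 0 < ε := by
    rw [hε]
    linarith
  set P : X →L[ℝ] X := U.starProjection with hP
  have hPU : ∀ x, P x ∈ U := fun x => U.starProjection_apply_mem x
  have hPU' : ∀ x, x - P x ∈ Uᗮ := fun x => U.sub_starProjection_mem_orthogonal x
  have hPn : ∀ x, ‖P x‖ ≤ ‖x‖ := fun x => U.norm_starProjection_apply_le x
  have hPn' : ∀ x, ‖x - P x‖ ≤ ‖x‖ := by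
    intro x
    have h1 := Uᗮ.norm_starProjection_apply_le x
    rwa [Submodule.starProjection_orthogonal_val] at h1
  have hPA : ∀ x, P (A x) = A (P x) := by
    intro x
    refine Submodule.eq_starProjection_of_mem_orthogonal (hAU _ (hPU x)) ?_
    rw [← map_sub]
    exact hAU' _ (hPU' x)
  obtain ⟨β, hβ, ⟨hβrot, hβcone⟩, hβmin⟩ := hΓ.exists_shortest
    (p := fun β => RotLE (linHom X β) ε ∧ ‖β 0 - P (β 0)‖ < ‖P (β 0)‖) (by
      obtain ⟨c, hc⟩ := hΓ.exists_small_rotation u hεpos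
      obtain ⟨t, ht, β, hβ, hβrot, hβc⟩ := hc ((2 * c + 1) / ‖u‖)
      refine ⟨β, hβ, hβrot, ?_⟩
      set w := β 0 - t • u with hw
      have hβw : β 0 = t • u + w := by rw [hw]; abel
      have hPu : P (t • u) = t • u :=
        Submodule.starProjection_eq_self_iff.2 (U.smul_mem t huU)
      have h1 : β 0 - P (β 0) = w - P w := by
        rw [hβw, map_add, hPu]
        abel
      have h2 : P (β 0) = t • u + P w := by rw [hβw, map_add, hPu]
      have h3 : ‖t • u‖ - ‖P w‖ ≤ ‖t • u + P w‖ := by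
        simpa using norm_sub_norm_le (t • u) (-P w)
      have h4 : 2 * c + 1 ≤ ‖t • u‖ := by
        rw [norm_smul]
        calc 2 * c + 1 ≤ t * ‖u‖ := (div_le_iff₀ hun).1 ht
          _ ≤ ‖t‖ * ‖u‖ := mul_le_mul_of_nonneg_right (Real.le_norm_self t) hun.le
      rw [h1, h2]
      linarith [hPn w, hPn' w])
  set b := β 0 with hb
  set φ := α * β * α⁻¹ * β⁻¹ with hφ
  have hφΓ : φ ∈ Γ := mul_mem (mul_mem (mul_mem hα hβ) (inv_mem hα)) (inv_mem hβ)
  set r := φ 0 - (A b - b) with hr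
  have hrn : ‖r‖ ≤ 2 * ε * ‖b‖ := by
    refine norm_commutator_sub_le hεpos.le hαrot hβrot ?_
    by_cases h : linHom X β = 1
    · exact Or.inl h
    · exact Or.inr (hαmin β hβ ⟨hβrot.mono (by rw [hε]; linarith), h⟩)
  have hφ0 : φ 0 = (A b - b) + r := by rw [hr]; abel
  have hbn : ‖b‖ ≤ ‖P b‖ + ‖b - P b‖ := by
    simpa using norm_add_le (P b) (b - P b)
  have hPbpos : 0 < ‖P b‖ := (norm_nonneg _).trans_lt hβcone
  have hφrot : RotLE (linHom X φ) ε := by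
    have h1 := hαrot.commutator (by norm_num) hεpos.le hβrot
    have h2 : linHom X φ = A * linHom X β * A⁻¹ * (linHom X β)⁻¹ := by
      rw [hφ]
      simp only [map_mul, map_inv]
      rfl
    rw [h2]
    exact h1.mono (by linarith)
  have hrn' : 2 * ‖r‖ < (m - m') * ‖P b‖ := by
    have h1 : 2 * ε * ‖b‖ < 2 * ε * (2 * ‖P b‖) :=
      mul_lt_mul_of_pos_left (by linarith) (by linarith)
    rw [hε] at h1 hrn
    linarith
  have hcone : ‖φ 0 - P (φ 0)‖ < ‖P (φ 0)‖ := by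
    have h1 : P (φ 0) = (A (P b) - P b) + P r := by
      rw [hφ0, map_add, map_sub, hPA]
    have h2 : φ 0 - P (φ 0) = (A (b - P b) - (b - P b)) + (r - P r) := by
      rw [h1, hφ0, map_sub A b (P b)]
      abel
    have h3 : ‖φ 0 - P (φ 0)‖ ≤ m' * ‖b - P b‖ + ‖r‖ := by
      rw [h2]
      exact (norm_add_le _ _).trans (add_le_add (hmU' _ (hPU' b)) (hPn' r))
    have h4 : m * ‖P b‖ - ‖r‖ ≤ ‖P (φ 0)‖ := by
      rw [h1, ← hmU _ (hPU b)]
      have := norm_sub_norm_le (A (P b) - P b) (-P r)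
      rw [norm_neg, sub_neg_eq_add] at this
      linarith [hPn r]
    have h5 : m' * ‖b - P b‖ ≤ m' * ‖P b‖ := mul_le_mul_of_nonneg_left hβcone.le hm'0
    linarith
  have h1 := hβmin φ hφΓ ⟨hφrot, hcone⟩
  have h2 : ‖φ 0‖ ≤ 1 / 2 * ‖b‖ + ‖r‖ := by
    rw [hφ0]
    exact (norm_add_le _ _).trans (add_le_add_left (hαrot b) _)
  have h3 : 0 < ‖b‖ := hPbpos.trans_le (hPn b)
  have h4 : 2 * ε * ‖b‖ ≤ 1 / 8 * ‖b‖ := mul_le_mul_of_nonneg_right (by rw [hε]; linarith) h3.le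
  linarith

/-- **Bieberbach's first theorem**: the translations of a space group span the space. -/
theorem IsSpaceGroup.spanOf_eq_top [FiniteDimensional ℝ X] {Γ : Subgroup (X ≃ᵢ X)}
    (hΓ : IsSpaceGroup Γ) : spanOf Γ = ⊤ := by
  by_contra hne
  have hne' : (spanOf Γ)ᗮ ≠ ⊥ := fun h => hne ((Submodule.orthogonal_eq_bot_iff).1 h)
  obtain ⟨u, hu, hu0⟩ := (spanOf Γ)ᗮ.exists_mem_ne_zero_of_ne_bot hne'
  have hun : 0 < ‖u‖ := norm_pos_iff.2 hu0
  obtain ⟨c, hc⟩ := hΓ.exists_small_rotation u (ε := 1 / 2) (by norm_num)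
  obtain ⟨t, ht, β, hβ, hrot, hβc⟩ := hc ((|c| + 1) / ‖u‖)
  have h1 : β 0 ∈ spanOf Γ := Submodule.subset_span (by
    change transIso (β 0) ∈ Γ
    rw [← eq_transIso_of_linHom_eq_one (hΓ.linHom_eq_one hβ hrot)]
    exact hβ)
  have h2 : inner ℝ (β 0) u = 0 := (Submodule.mem_orthogonal _ u).1 hu _ h1
  have h3 : (|c| + 1) ≤ t * ‖u‖ := (div_le_iff₀ hun).1 ht
  have h4 : t * ‖u‖ * ‖u‖ ≤ ‖β 0 - t • u‖ * ‖u‖ := by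
    have h5 := real_inner_le_norm (-(β 0 - t • u)) u
    rw [inner_neg_left, inner_sub_left, h2, inner_smul_left, real_inner_self_eq_norm_sq,
      norm_neg] at h5
    simp only [RCLike.conj_to_real] at h5
    linarith
  have h5 := le_of_mul_le_mul_right h4 hun
  linarith [le_abs_self c]

end SpaceGroup

lemma transIso_zero {X : Type*} [SeminormedAddCommGroup X] : transIso (0 : X) = 1 := by
  ext x
  simp

lemma transIso_add {X : Type*} [SeminormedAddCommGroup X] (a b : X) :
    transIso (a + b) = transIso a * transIso b := by
  ext x
  simp [IsometryEquiv.mul_apply, add_assoc]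

lemma transIso_neg {X : Type*} [SeminormedAddCommGroup X] (a : X) :
    transIso (-a) = (transIso a)⁻¹ := by
  rw [eq_inv_iff_mul_eq_one, ← transIso_add, neg_add_cancel, transIso_zero]

section Coordinates

variable {X : Type*} [NormedAddCommGroup X] [InnerProductSpace ℝ X]

lemma mul_transIso (γ : X ≃ᵢ X) (a : X) : γ * transIso a = transIso (linHom X γ a) * γ := by
  ext x
  rw [IsometryEquiv.mul_apply, IsometryEquiv.mul_apply, transIso_apply, transIso_apply, add_comm a,
    isometry_add, add_comm]

lemma transIso_linHom_mem {Γ : Subgroup (X ≃ᵢ X)} {γ : X ≃ᵢ X} (hγ : γ ∈ Γ) {a : X}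
    (ha : transIso a ∈ Γ) : transIso (linHom X γ a) ∈ Γ := by
  rw [eq_mul_inv_of_mul_eq (mul_transIso γ a).symm]
  exact mul_mem (mul_mem hγ ha) (inv_mem hγ)

/-- The translation vectors of a group of isometries. -/
def transLattice (Γ : Subgroup (X ≃ᵢ X)) : Submodule ℤ X :=
  AddSubgroup.toIntSubmodule
    { carrier := {a | transIso a ∈ Γ}
      add_mem' := fun {a b} ha hb => by
        rw [Set.mem_ofPred_eq, transIso_add]
        exact mul_mem ha hb
      zero_mem' := by
        rw [Set.mem_ofPred_eq, transIso_zero]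
        exact one_mem Γ
      neg_mem' := fun {a} ha => by
        rw [Set.mem_ofPred_eq, transIso_neg]
        exact inv_mem ha }

lemma IsSpaceGroup.discreteTopology_transLattice [FiniteDimensional ℝ X] {Γ : Subgroup (X ≃ᵢ X)}
    (hΓ : IsSpaceGroup Γ) : DiscreteTopology (transLattice Γ) := by
  by_cases hex : ∃ γ ∈ Γ, linHom X γ = 1 ∧ γ 0 ≠ 0
  · obtain ⟨γ, -, ⟨-, hγ0⟩, hmin⟩ := hΓ.exists_shortest hex
    refine DiscreteTopology.of_forall_le_dist (norm_pos_iff.2 hγ0) fun x y hxy => ?_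
    have h1 := hmin (transIso (x - y : X)) (sub_mem x.2 y.2) ⟨linHom_transIso _, by
      simpa [sub_eq_zero] using hxy⟩
    rwa [transIso_apply, add_zero, ← dist_eq_norm] at h1
  · push Not at hex
    have : Subsingleton (transLattice Γ) := ⟨fun x y => by
      have h (z : transLattice Γ) : (z : X) = 0 := by
        simpa using hex (transIso z) z.2 (linHom_transIso _)
      exact Subtype.ext ((h x).trans (h y).symm)⟩
    infer_instance

/-- Linear coordinates in which the translations of `Γ` are exactly the integer vectors. -/
def IsLatticeCoord {ι : Type*} (Γ : Subgroup (X ≃ᵢ X)) (c : X ≃ₗ[ℝ] (ι → ℝ)) : Prop :=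
  ∀ a, transIso a ∈ Γ ↔ ∃ l : ι → ℤ, ∀ i, c a i = l i

lemma isLatticeCoord_of_basis {ι : Type*} [Finite ι] [FiniteDimensional ℝ X]
    {Γ : Subgroup (X ≃ᵢ X)} [DiscreteTopology (transLattice Γ)] [IsZLattice ℝ (transLattice Γ)]
    (b : Module.Basis ι ℤ (transLattice Γ)) :
    IsLatticeCoord Γ (b.ofZLatticeBasis ℝ).equivFun := by
  intro a
  constructor
  · intro ha
    exact ⟨fun i => b.repr ⟨a, ha⟩ i, fun i =>
      b.ofZLatticeBasis_repr_apply ℝ (transLattice Γ) ⟨a, ha⟩ i⟩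
  · rintro ⟨l, hl⟩
    have h1 : a = (b.equivFun.symm l : transLattice Γ) := by
      refine (b.ofZLatticeBasis ℝ).equivFun.injective (funext fun i => ?_)
      rw [hl]
      have h2 := b.ofZLatticeBasis_repr_apply ℝ (transLattice Γ) (b.equivFun.symm l) i
      rw [Module.Basis.equivFun_apply, h2, ← Module.Basis.equivFun_apply,
        LinearEquiv.apply_symm_apply]
    rw [h1]
    exact (b.equivFun.symm l).2

lemma IsLatticeCoord.exists_fract {ι : Type*} {Γ : Subgroup (X ≃ᵢ X)} {c : X ≃ₗ[ℝ] (ι → ℝ)}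
    (hc : IsLatticeCoord Γ c) {γ : X ≃ᵢ X} (hγ : γ ∈ Γ) :
    ∃ δ ∈ Γ, linHom X δ = linHom X γ ∧ ∀ i, 0 ≤ c (δ 0) i ∧ c (δ 0) i < 1 := by
  set a := c.symm fun i => ((-⌊c (γ 0) i⌋ : ℤ) : ℝ) with ha
  refine ⟨transIso a * γ, mul_mem ((hc a).2 ⟨_, fun i => by rw [ha, c.apply_symm_apply]⟩) hγ,
    ?_, fun i => ?_⟩
  · rw [map_mul, linHom_transIso, one_mul]
  · have h1 : c ((transIso a * γ) 0) i = Int.fract (c (γ 0) i) := by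
      rw [IsometryEquiv.mul_apply, transIso_apply, map_add, Pi.add_apply, ha,
        c.apply_symm_apply, Int.cast_neg, Int.fract]
      ring
    rw [h1]
    exact ⟨Int.fract_nonneg _, Int.fract_lt_one _⟩

lemma IsSpaceGroup.finite_pointGroup [FiniteDimensional ℝ X] {ι : Type*} [Finite ι]
    {Γ : Subgroup (X ≃ᵢ X)} (hΓ : IsSpaceGroup Γ) {c : X ≃ₗ[ℝ] (ι → ℝ)}
    (hc : IsLatticeCoord Γ c) : Finite (Γ.map (linHom X)) := by
  have := Fintype.ofFinite ι
  have hcont : Continuous c.symm := LinearMap.continuous_of_finiteDimensional c.symm.toLinearMap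
  obtain ⟨R, hR⟩ := ((isCompact_Icc (a := (0 : ι → ℝ)) (b := 1)).image
    hcont).isBounded.exists_norm_le
  refine Set.Finite.to_subtype (((hΓ.finite_short R).image (linHom X)).subset ?_)
  rintro _ ⟨γ, hγ, rfl⟩
  obtain ⟨δ, hδ, hδγ, hfr⟩ := hc.exists_fract hγ
  refine ⟨δ, ⟨hδ, hR _ ⟨c (δ 0), ⟨fun i => (hfr i).1, fun i => (hfr i).2.le⟩,
    c.symm_apply_apply _⟩⟩, hδγ⟩

end Coordinates

section AdaptedCoordinates

variable {X : Type*} [NormedAddCommGroup X] [InnerProductSpace ℝ X]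

/-- `M` is the matrix of the orthogonal map `A` in the coordinates `c`. -/
def HasMatrix {ι : Type*} [Fintype ι] (c : X ≃ₗ[ℝ] (ι → ℝ)) (A : X ≃ₗᵢ[ℝ] X)
    (M : Matrix ι ι ℤ) : Prop :=
  ∀ x, c (A x) = (M.map (Int.castRingHom ℝ)).mulVec (c x)

lemma HasMatrix.mul {ι : Type*} [Fintype ι] {c : X ≃ₗ[ℝ] (ι → ℝ)} {A A' : X ≃ₗᵢ[ℝ] X}
    {M M' : Matrix ι ι ℤ} (h : HasMatrix c A M) (h' : HasMatrix c A' M') :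
    HasMatrix c (A * A') (M * M') := by
  intro x
  rw [Matrix.map_mul, ← Matrix.mulVec_mulVec, ← h', ← h]
  rfl

lemma HasMatrix.left_unique {ι : Type*} [Fintype ι] {c : X ≃ₗ[ℝ] (ι → ℝ)} {A A' : X ≃ₗᵢ[ℝ] X}
    {M : Matrix ι ι ℤ} (h : HasMatrix c A M) (h' : HasMatrix c A' M) : A = A' := by
  ext x
  exact c.injective ((h x).trans (h' x).symm)

lemma HasMatrix.right_unique {ι : Type*} [Fintype ι] {c : X ≃ₗ[ℝ] (ι → ℝ)} {A : X ≃ₗᵢ[ℝ] X}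
    {M M' : Matrix ι ι ℤ} (h : HasMatrix c A M) (h' : HasMatrix c A M') : M = M' := by
  have h1 : M.map (Int.castRingHom ℝ) = M'.map (Int.castRingHom ℝ) := by
    refine Matrix.mulVec_injective (funext fun v => ?_)
    have h2 := (h (c.symm v)).symm.trans (h' (c.symm v))
    rwa [c.apply_symm_apply] at h2
  exact Matrix.map_injective (RingHom.injective_int _) h1

/-- A pair of a space group and a complete normal subgroup has adapted lattice coordinates in
which its point group is given by integer matrices with bounded entries. -/
lemma exists_adapted_coord (n : ℕ) : ∃ B : ℕ, ∀ (X : Type) [NormedAddCommGroup X]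
    [InnerProductSpace ℝ X] [FiniteDimensional ℝ X], Module.finrank ℝ X = n →
    ∀ Γ N : Subgroup (X ≃ᵢ X), IsSpaceGroup Γ → IsCompleteNormal Γ N →
    ∃ (c : X ≃ₗ[ℝ] (Fin n → ℝ)) (J : Set (Fin n)), IsLatticeCoord Γ c ∧
      (∀ x, x ∈ spanOf N ↔ ∀ j ∉ J, c x j = 0) ∧
      ∀ γ ∈ Γ, ∃ M : Matrix (Fin n) (Fin n) ℤ, (∀ i j, |M i j| ≤ B) ∧
        HasMatrix c (linHom X γ) M := by
  obtain ⟨B, hB⟩ := exists_adapted_basis n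
  refine ⟨B, fun X _ _ _ hX Γ N hΓ hN => ?_⟩
  have hdisc := hΓ.discreteTopology_transLattice
  have hlat : IsZLattice ℝ (transLattice Γ) := ⟨hΓ.spanOf_eq_top⟩
  set L := transLattice Γ with hL
  have hfin : Finite (Γ.map (linHom X)) :=
    hΓ.finite_pointGroup (isLatticeCoord_of_basis (Module.Free.chooseBasis ℤ L))
  have hGL : ∀ g : Γ.map (linHom X), ∀ x ∈ L, (g : X ≃ₗᵢ[ℝ] X) x ∈ L := by
    rintro ⟨_, γ, hγ, rfl⟩ x hx
    exact transIso_linHom_mem hγ hx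
  let ρ : Γ.map (linHom X) →* Module.End ℤ L :=
    { toFun := fun g => ((g : X ≃ₗᵢ[ℝ] X).toLinearEquiv.toLinearMap.restrictScalars ℤ).restrict
        (hGL g)
      map_one' := rfl
      map_mul' := fun _ _ => rfl }
  have hρ : ∀ g x, (ρ g x : X) = (g : X ≃ₗᵢ[ℝ] X) x := fun g x => rfl
  let W : Submodule ℤ L := ((spanOf N).restrictScalars ℤ).comap L.subtype
  have hW : ∀ x : L, x ∈ W ↔ (x : X) ∈ spanOf N := fun x => Iff.rfl
  have hsat : IsSaturated W := by
    intro k hk x hx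
    rw [hW] at hx ⊢
    have h1 : ((k : ℝ) • (x : X)) ∈ spanOf N := by
      rw [Int.cast_smul_eq_zsmul]
      exact hx
    exact ((spanOf N).smul_mem_iff (Int.cast_ne_zero.2 hk)).1 h1
  have hinv : ∀ g, ∀ x ∈ W, ρ g x ∈ W := by
    rintro ⟨_, γ, hγ, rfl⟩ x hx
    rw [hW] at hx ⊢
    rw [hρ]
    have h1 : spanOf N ≤ (spanOf N).comap (linHom X γ).toLinearEquiv.toLinearMap := by
      refine Submodule.span_le.2 fun a ha => Submodule.subset_span ?_
      change transIso (linHom X γ a) ∈ N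
      rw [eq_mul_inv_of_mul_eq (mul_transIso γ a).symm]
      exact hN.2.1 γ hγ _ ha
    exact h1 hx
  obtain ⟨b, J, hbJ, hWJ, hent⟩ := hB (Γ.map (linHom X)) L ρ W hsat hinv
    ((ZLattice.rank ℝ L).trans hX)
  have hbc : ∀ x : L, ∀ i, (b.ofZLatticeBasis ℝ L).equivFun x i = b.repr x i := fun x i =>
    b.ofZLatticeBasis_repr_apply ℝ L x i
  refine ⟨(b.ofZLatticeBasis ℝ L).equivFun, J, isLatticeCoord_of_basis b, fun x => ⟨?_, ?_⟩,
    fun γ hγ => ?_⟩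
  · intro hx j hj
    have h1 : spanOf N ≤ LinearMap.ker ((LinearMap.proj j).comp
        (b.ofZLatticeBasis ℝ L).equivFun.toLinearMap) := by
      refine Submodule.span_le.2 fun a ha => ?_
      have h2 := hWJ ⟨a, hN.1 ha⟩ (Submodule.subset_span ha) j hj
      have h3 := hbc ⟨a, hN.1 ha⟩ j
      rw [h2, Int.cast_zero] at h3
      exact h3
    exact h1 hx
  · intro h
    rw [← (b.ofZLatticeBasis ℝ L).sum_equivFun x]
    refine sum_mem fun i _ => ?_
    by_cases hi : i ∈ J
    · refine (spanOf N).smul_mem _ ?_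
      rw [b.ofZLatticeBasis_apply ℝ L]
      exact hbJ i hi
    · rw [h i hi, zero_smul]
      exact zero_mem _
  · set g : Γ.map (linHom X) := ⟨linHom X γ, γ, hγ, rfl⟩ with hg
    refine ⟨Matrix.of fun i j => b.repr (ρ g (b j)) i, fun i j => hent g i j, ?_⟩
    intro x
    have key : (b.ofZLatticeBasis ℝ L).equivFun.toLinearMap ∘ₗ
        (linHom X γ).toLinearEquiv.toLinearMap =
        ((Matrix.of fun i j => b.repr (ρ g (b j)) i).map (Int.castRingHom ℝ)).mulVecLin ∘ₗ
        (b.ofZLatticeBasis ℝ L).equivFun.toLinearMap := by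
      refine (b.ofZLatticeBasis ℝ L).ext fun j => funext fun i => ?_
      have h1 := hbc (ρ g (b j)) i
      rw [hρ] at h1
      simp only [LinearMap.comp_apply, LinearEquiv.coe_coe, Matrix.mulVecLin_apply]
      rw [b.ofZLatticeBasis_apply ℝ L]
      refine h1.trans ?_
      simp [Matrix.mulVec, dotProduct, Finsupp.single_apply]
    exact LinearMap.congr_fun key x

end AdaptedCoordinates

section Datum

/-- The group `Γ` is presented as a set of pairs of an integer vector and a matrix in `F`, with
multiplication table determined by the cocycle whose graph is `C`; the subgroup `N` corresponds to
the pairs with vector supported on `J` and matrix in `P`. -/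
def HasDatum {ι 𝒢 : Type*} [Fintype ι] [Group 𝒢] (Γ N : Subgroup 𝒢) (J : Set ι)
    (F P : Set (Matrix ι ι ℤ)) (C : Set (Matrix ι ι ℤ × Matrix ι ι ℤ × (ι → ℤ))) : Prop :=
  ∃ e : (ι → ℤ) × F → 𝒢, Function.Injective e ∧ Set.range e = Γ ∧
    (∀ p q : (ι → ℤ) × F, ∃ k, ((p.2 : Matrix ι ι ℤ), (q.2 : Matrix ι ι ℤ), k) ∈ C) ∧
    (∀ (p q : (ι → ℤ) × F) (k : ι → ℤ), ((p.2 : Matrix ι ι ℤ), (q.2 : Matrix ι ι ℤ), k) ∈ C →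
      ∃ h : (p.2 * q.2 : Matrix ι ι ℤ) ∈ F,
        e p * e q = e (p.1 + (p.2 : Matrix ι ι ℤ).mulVec q.1 + k, ⟨p.2 * q.2, h⟩)) ∧
    ∀ p : (ι → ℤ) × F, e p ∈ N ↔ (∀ j ∉ J, p.1 j = 0) ∧ (p.2 : Matrix ι ι ℤ) ∈ P

/-- Two pairs with the same datum are isomorphic. -/
lemma HasDatum.exists_mulEquiv {ι 𝒢 𝒢' : Type*} [Fintype ι] [Group 𝒢] [Group 𝒢']
    {Γ N : Subgroup 𝒢} {Γ' N' : Subgroup 𝒢'} {J : Set ι} {F P : Set (Matrix ι ι ℤ)}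
    {C : Set (Matrix ι ι ℤ × Matrix ι ι ℤ × (ι → ℤ))}
    (h : HasDatum Γ N J F P C) (h' : HasDatum Γ' N' J F P C) :
    ∃ ζ : Γ ≃* Γ', ∀ x : Γ, (x : 𝒢) ∈ N ↔ (ζ x : 𝒢') ∈ N' := by
  obtain ⟨e, hinj, hran, hC, hmul, hN⟩ := h
  obtain ⟨e', hinj', hran', -, hmul', hN'⟩ := h'
  have hm : ∀ p, e p ∈ Γ := fun p => by
    rw [← SetLike.mem_coe, ← hran]
    exact ⟨p, rfl⟩
  have hm' : ∀ p, e' p ∈ Γ' := fun p => by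
    rw [← SetLike.mem_coe, ← hran']
    exact ⟨p, rfl⟩
  let f : (ι → ℤ) × F ≃ Γ := Equiv.ofBijective (fun p => ⟨e p, hm p⟩)
    ⟨fun p q hpq => hinj (congrArg Subtype.val hpq), fun ⟨x, hx⟩ => by
      rw [← SetLike.mem_coe, ← hran] at hx
      obtain ⟨p, rfl⟩ := hx
      exact ⟨p, rfl⟩⟩
  let f' : (ι → ℤ) × F ≃ Γ' := Equiv.ofBijective (fun p => ⟨e' p, hm' p⟩)
    ⟨fun p q hpq => hinj' (congrArg Subtype.val hpq), fun ⟨x, hx⟩ => by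
      rw [← SetLike.mem_coe, ← hran'] at hx
      obtain ⟨p, rfl⟩ := hx
      exact ⟨p, rfl⟩⟩
  have hf : ∀ p, (f p : 𝒢) = e p := fun p => rfl
  have hf' : ∀ p, (f' p : 𝒢') = e' p := fun p => rfl
  refine ⟨{ toEquiv := f.symm.trans f', map_mul' := fun x y => ?_ }, fun x => ?_⟩
  · obtain ⟨p, rfl⟩ := f.surjective x
    obtain ⟨q, rfl⟩ := f.surjective y
    obtain ⟨k, hk⟩ := hC p q
    obtain ⟨hF, hpq⟩ := hmul p q k hk
    obtain ⟨_, hpq'⟩ := hmul' p q k hk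
    have h1 : f p * f q = f (p.1 + (p.2 : Matrix ι ι ℤ).mulVec q.1 + k, ⟨p.2 * q.2, hF⟩) :=
      Subtype.ext hpq
    have h2 : f' p * f' q = f' (p.1 + (p.2 : Matrix ι ι ℤ).mulVec q.1 + k, ⟨p.2 * q.2, hF⟩) :=
      Subtype.ext hpq'
    simp only [Equiv.toFun_as_coe, Equiv.trans_apply, Equiv.symm_apply_apply, h1, h2]
  · obtain ⟨p, rfl⟩ := f.surjective x
    change (f p : 𝒢) ∈ N ↔ (f' (f.symm (f p)) : 𝒢') ∈ N'
    rw [Equiv.symm_apply_apply, hf, hf', hN, hN']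

lemma finite_setOf_matrix_abs_le {ι : Type*} [Finite ι] (B : ℤ) :
    {M : Matrix ι ι ℤ | ∀ i j, |M i j| ≤ B}.Finite := by
  have h : ∀ _ : ι, {v : ι → ℤ | ∀ i, v i ∈ Set.Icc (-B) B}.Finite := fun _ =>
    Set.Finite.pi' fun _ => Set.finite_Icc _ _
  refine (Set.Finite.pi' h).subset fun M hM i j => ?_
  exact abs_le.1 (hM i j)

lemma finite_setOf_abs_le {ι : Type*} [Finite ι] (B : ℤ) :
    {v : ι → ℤ | ∀ i, |v i| ≤ B}.Finite :=
  (Set.Finite.pi' fun _ : ι => Set.finite_Icc (-B) B).subset fun _ hv i => abs_le.1 (hv i)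

variable {X : Type*} [NormedAddCommGroup X] [InnerProductSpace ℝ X]

lemma IsLatticeCoord.exists_eq_transIso_mul {ι : Type*} {Γ : Subgroup (X ≃ᵢ X)}
    {c : X ≃ₗ[ℝ] (ι → ℝ)} (hc : IsLatticeCoord Γ c) {γ δ : X ≃ᵢ X} (hγ : γ ∈ Γ) (hδ : δ ∈ Γ)
    (h : linHom X γ = linHom X δ) :
    ∃ l : ι → ℤ, γ = transIso (c.symm fun i => (l i : ℝ)) * δ := by
  have h1 : linHom X (γ * δ⁻¹) = 1 := by
    rw [map_mul, h, ← map_mul, mul_inv_cancel, map_one]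
  have h2 := eq_transIso_of_linHom_eq_one h1
  have h3 : γ * δ⁻¹ ∈ Γ := mul_mem hγ (inv_mem hδ)
  rw [h2] at h3
  obtain ⟨l, hl⟩ := (hc _).1 h3
  refine ⟨l, ?_⟩
  have h4 : (c.symm fun i => (l i : ℝ)) = (γ * δ⁻¹) 0 := by
    rw [LinearEquiv.symm_apply_eq]
    exact funext fun i => (hl i).symm
  rw [h4, ← h2, inv_mul_cancel_right]

lemma IsCompleteNormal.mem_iff {Γ N : Subgroup (X ≃ᵢ X)} (hN : IsCompleteNormal Γ N) {φ : X ≃ᵢ X}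
    (hφ : φ ∈ Γ) :
    φ ∈ N ↔ φ 0 ∈ spanOf N ∧ ∀ w ∈ (spanOf N)ᗮ, linHom X φ w = w :=
  hN.2.2 φ hφ _ _ (isometry_eq_add_linHom φ)

/-- Adapted coordinates provide a datum with bounded entries. -/
lemma exists_hasDatum {n : ℕ} {B : ℕ} {Γ N : Subgroup (X ≃ᵢ X)} (hN : IsCompleteNormal Γ N)
    {c : X ≃ₗ[ℝ] (Fin n → ℝ)} {J : Set (Fin n)} (hc : IsLatticeCoord Γ c)
    (hJ : ∀ x, x ∈ spanOf N ↔ ∀ j ∉ J, c x j = 0)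
    (hM : ∀ γ ∈ Γ, ∃ M : Matrix (Fin n) (Fin n) ℤ, (∀ i j, |M i j| ≤ B) ∧
      HasMatrix c (linHom X γ) M) :
    ∃ F P C, F ⊆ {M : Matrix (Fin n) (Fin n) ℤ | ∀ i j, |M i j| ≤ (B : ℤ)} ∧ P ⊆ F ∧
      C ⊆ F ×ˢ F ×ˢ {v : Fin n → ℤ | ∀ i, |v i| ≤ ((n * B + 2 : ℕ) : ℤ)} ∧
      HasDatum Γ N J F P C := by
  set F : Set (Matrix (Fin n) (Fin n) ℤ) := {M | ∃ γ ∈ Γ, HasMatrix c (linHom X γ) M} with hF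
  have hFB : ∀ M ∈ F, ∀ i j, |M i j| ≤ (B : ℤ) := by
    rintro M ⟨γ, hγ, hγM⟩
    obtain ⟨M', hM'B, hM'⟩ := hM γ hγ
    rwa [hγM.right_unique hM']
  have hex : ∀ M : F, ∃ γ ∈ Γ, HasMatrix c (linHom X γ) M ∧
      ∀ i, 0 ≤ c (γ 0) i ∧ c (γ 0) i < 1 := by
    rintro ⟨M, γ, hγ, hγM⟩
    obtain ⟨δ, hδ, hδγ, hfr⟩ := hc.exists_fract hγ
    exact ⟨δ, hδ, by rwa [hδγ], hfr⟩
  choose γ hγ hγM hfr using hex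
  have hFmul : ∀ M M' : F, (M * M' : Matrix (Fin n) (Fin n) ℤ) ∈ F := fun M M' =>
    ⟨γ M * γ M', mul_mem (hγ M) (hγ M'), by
      rw [map_mul]
      exact (hγM M).mul (hγM M')⟩
  set t : (Fin n → ℤ) → (X ≃ᵢ X) := fun l => transIso (c.symm fun i => (l i : ℝ)) with ht
  have htΓ : ∀ l, t l ∈ Γ := fun l => (hc _).2 ⟨l, fun i => by rw [c.apply_symm_apply]⟩
  have htadd : ∀ l l', t (l + l') = t l * t l' := fun l l' => by
    rw [ht]
    simp only
    rw [← transIso_add, ← map_add]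
    congr 2
    ext i
    simp
  have htM : ∀ (M : F) (l : Fin n → ℤ), γ M * t l = t ((M : Matrix _ _ ℤ).mulVec l) * γ M := by
    intro M l
    rw [ht]
    simp only
    rw [mul_transIso]
    congr 2
    refine c.injective ?_
    rw [hγM M, c.apply_symm_apply, c.apply_symm_apply]
    ext i
    simp [Matrix.mulVec, dotProduct]
  have hct : ∀ (l : Fin n → ℤ) (φ : X ≃ᵢ X) i, c ((t l * φ) 0) i = l i + c (φ 0) i := by
    intro l φ i
    rw [IsometryEquiv.mul_apply, ht, transIso_apply, map_add, c.apply_symm_apply]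
    rfl
  have hlin : ∀ (l : Fin n → ℤ) (φ : X ≃ᵢ X), linHom X (t l * φ) = linHom X φ := fun l φ => by
    rw [map_mul, linHom_transIso, one_mul]
  set C : Set (Matrix (Fin n) (Fin n) ℤ × Matrix (Fin n) (Fin n) ℤ × (Fin n → ℤ)) :=
    {q | ∃ M M' : F, q.1 = M ∧ q.2.1 = M' ∧
      γ M * γ M' = t q.2.2 * γ ⟨M * M', hFmul M M'⟩} with hC
  refine ⟨F, {M | ∃ h : M ∈ F, γ ⟨M, h⟩ ∈ N}, C, hFB, fun M hM => hM.1, ?_,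
    fun p => t p.1 * γ p.2, ?_, ?_, ?_, ?_, ?_⟩
  · rintro ⟨_, _, k⟩ ⟨M, M', rfl, rfl, h⟩
    refine ⟨M.2, M'.2, fun i => ?_⟩
    have h1 := hct k (γ ⟨M * M', hFmul M M'⟩) i
    have h2 : c ((γ M * γ M') 0) i = c (γ M 0) i + ∑ j, (M.1 i j : ℝ) * c (γ M' 0) j := by
      rw [IsometryEquiv.mul_apply, isometry_eq_add_linHom (γ M), map_add, hγM M]
      rfl
    simp only at h
    rw [← h, h2] at h1
    have h3 : |∑ j, (M.1 i j : ℝ) * c (γ M' 0) j| ≤ n * B := by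
      refine (Finset.abs_sum_le_sum_abs _ _).trans ?_
      refine (Finset.sum_le_card_nsmul _ _ (B : ℝ) fun j _ => ?_).trans (by simp)
      rw [abs_mul]
      have h4 : |(M.1 i j : ℝ)| ≤ B := by exact_mod_cast hFB M M.2 i j
      have h5 : |c (γ M' 0) j| ≤ 1 := abs_le.2 ⟨by linarith [(hfr M' j).1], (hfr M' j).2.le⟩
      calc _ ≤ (B : ℝ) * 1 := mul_le_mul h4 h5 (abs_nonneg _) (by positivity)
        _ = B := mul_one _
    have h6 : |(k i : ℝ)| ≤ n * B + 2 := by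
      rw [abs_le] at h3 ⊢
      have h7 := hfr M i
      have h8 := hfr ⟨M * M', hFmul M M'⟩ i
      constructor <;> linarith [h7.1, h7.2, h8.1, h8.2]
    simp only
    exact_mod_cast h6
  · rintro ⟨l, M⟩ ⟨l', M'⟩ h
    simp only at h
    have hMM : M = M' := by
      have h1 : linHom X (γ M) = linHom X (γ M') := by rw [← hlin l, h, hlin]
      have h2 := hγM M
      rw [h1] at h2
      exact Subtype.ext (h2.right_unique (hγM M'))
    subst hMM
    have hl : l = l' := by
      ext i
      have h1 := hct l (γ M) i
      rw [h, hct] at h1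
      exact_mod_cast (add_right_cancel h1).symm
    rw [hl]
  · ext φ
    constructor
    · rintro ⟨p, rfl⟩
      exact mul_mem (htΓ _) (hγ _)
    · intro hφ
      obtain ⟨M, -, hφM⟩ := hM φ hφ
      set M' : F := ⟨M, φ, hφ, hφM⟩ with hM'
      obtain ⟨l, hl⟩ := hc.exists_eq_transIso_mul hφ (hγ M') (hφM.left_unique (hγM M'))
      exact ⟨(l, M'), hl.symm⟩
  · rintro ⟨-, M⟩ ⟨-, M'⟩
    obtain ⟨k, hk⟩ := hc.exists_eq_transIso_mul (mul_mem (hγ M) (hγ M'))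
      (hγ ⟨M.1 * M'.1, hFmul M M'⟩) (by
        refine HasMatrix.left_unique (M := M.1 * M'.1) ?_ (hγM ⟨M.1 * M'.1, hFmul M M'⟩)
        rw [map_mul]
        exact (hγM M).mul (hγM M'))
    exact ⟨k, M, M', rfl, rfl, hk⟩
  · rintro ⟨l, M⟩ ⟨l', M'⟩ k ⟨M₁, M₁', h1, h2, hk⟩
    obtain rfl := Subtype.ext h1
    obtain rfl := Subtype.ext h2
    refine ⟨hFmul _ _, ?_⟩
    simp only at hk ⊢
    rw [htadd, htadd, mul_assoc _ (t k), ← hk, mul_assoc, ← mul_assoc (γ M), htM]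
    simp only [mul_assoc]
  · rintro ⟨l, M⟩
    simp only
    rw [hN.mem_iff (mul_mem (htΓ l) (hγ M)), hlin, hJ]
    simp only [hct]
    have h1 : (M : Matrix (Fin n) (Fin n) ℤ) ∈ {M | ∃ h : M ∈ F, γ ⟨M, h⟩ ∈ N} ↔ γ M ∈ N :=
      ⟨fun h => h.2, fun h => ⟨M.2, h⟩⟩
    rw [h1, hN.mem_iff (hγ M), hJ]
    have h2 : ∀ j, (l j : ℝ) + c (γ M 0) j = 0 ↔ l j = 0 ∧ c (γ M 0) j = 0 := by
      intro j
      refine ⟨fun h => ?_, fun h => by simp [h.1, h.2]⟩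
      have h3 := hfr M j
      have h4 : (-1 : ℝ) < l j := by linarith
      have h5 : (l j : ℝ) ≤ 0 := by linarith
      have h6 : (-1 : ℤ) < l j := by exact_mod_cast h4
      have h7 : l j ≤ 0 := by exact_mod_cast h5
      have h8 : l j = 0 := by lia
      rw [h8, Int.cast_zero, zero_add] at h
      exact ⟨h8, h⟩
    simp only [h2]
    exact ⟨fun h => ⟨fun j hj => (h.1 j hj).1, fun j hj => (h.1 j hj).2, h.2⟩,
      fun h => ⟨fun j hj => ⟨h.1 j hj, h.2.1 j hj⟩, h.2.2⟩⟩

end Datum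

/-- **Theorem 4 (the relative Bieberbach theorem)**: for each dimension `n`, there are
only finitely many isomorphism classes of pairs of groups `(Γ, N)` such that `Γ` is an
`n`-space group and `N` is a normal subgroup of `Γ` such that `Γ/N` is a space group
(equivalently, `N` is a complete normal subgroup of `Γ`): there is a finite list of such
pairs so that every such pair is isomorphic, by a group isomorphism `ζ : Γ → Γᵢ` with
`ζ(N) = Nᵢ`, to one on the list. -/
theorem relative_bieberbach (n : ℕ) :
    ∃ S : Set (Subgroup (EuclideanSpace ℝ (Fin n) ≃ᵢ EuclideanSpace ℝ (Fin n)) ×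
        Subgroup (EuclideanSpace ℝ (Fin n) ≃ᵢ EuclideanSpace ℝ (Fin n))),
      S.Finite ∧
      (∀ p ∈ S, IsSpaceGroup p.1 ∧ IsCompleteNormal p.1 p.2) ∧
      ∀ Γ N : Subgroup (EuclideanSpace ℝ (Fin n) ≃ᵢ EuclideanSpace ℝ (Fin n)),
        IsSpaceGroup Γ → IsCompleteNormal Γ N →
        ∃ p ∈ S, ∃ ζ : Γ ≃* ↥p.1,
          ∀ x : Γ, (x : EuclideanSpace ℝ (Fin n) ≃ᵢ EuclideanSpace ℝ (Fin n)) ∈ N ↔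
            ((ζ x : ↥p.1) : EuclideanSpace ℝ (Fin n) ≃ᵢ EuclideanSpace ℝ (Fin n)) ∈ p.2 := by
  classical
  obtain ⟨B, hB⟩ := exists_adapted_coord n
  let box : Set (Matrix (Fin n) (Fin n) ℤ) := {M | ∀ i j, |M i j| ≤ (B : ℤ)}
  let cbox : Set (Fin n → ℤ) := {v | ∀ i, |v i| ≤ ((n * B + 2 : ℕ) : ℤ)}
  have hbox : box.Finite := finite_setOf_matrix_abs_le _
  have hcbox : cbox.Finite := finite_setOf_abs_le _
  let D : Set (Set (Fin n) × Set (Matrix (Fin n) (Fin n) ℤ) × Set (Matrix (Fin n) (Fin n) ℤ) ×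
      Set (Matrix (Fin n) (Fin n) ℤ × Matrix (Fin n) (Fin n) ℤ × (Fin n → ℤ))) :=
    Set.univ ×ˢ {F | F ⊆ box} ×ˢ {P | P ⊆ box} ×ˢ {C | C ⊆ box ×ˢ box ×ˢ cbox}
  have hD : D.Finite := Set.finite_univ.prod (hbox.finite_subsets.prod (hbox.finite_subsets.prod
    (hbox.prod (hbox.prod hcbox)).finite_subsets))
  let good (d : Set (Fin n) × Set (Matrix (Fin n) (Fin n) ℤ) × Set (Matrix (Fin n) (Fin n) ℤ) ×
      Set (Matrix (Fin n) (Fin n) ℤ × Matrix (Fin n) (Fin n) ℤ × (Fin n → ℤ)))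
      (p : Subgroup (EuclideanSpace ℝ (Fin n) ≃ᵢ EuclideanSpace ℝ (Fin n)) ×
        Subgroup (EuclideanSpace ℝ (Fin n) ≃ᵢ EuclideanSpace ℝ (Fin n))) : Prop :=
    IsSpaceGroup p.1 ∧ IsCompleteNormal p.1 p.2 ∧ HasDatum p.1 p.2 d.1 d.2.1 d.2.2.1 d.2.2.2
  choose f hf using fun d : {d // d ∈ D ∧ ∃ p, good d p} => d.2.2
  have : Finite {d // d ∈ D ∧ ∃ p, good d p} := (hD.subset fun d hd => hd.1).to_subtype
  refine ⟨Set.range f, Set.finite_range f, ?_, fun Γ N hΓ hN => ?_⟩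
  · rintro _ ⟨d, rfl⟩
    exact ⟨(hf d).1, (hf d).2.1⟩
  · obtain ⟨c, J, hc, hJ, hM⟩ := hB _ finrank_euclideanSpace_fin Γ N hΓ hN
    obtain ⟨F, P, C, hF, hP, hC, hdat⟩ := exists_hasDatum hN hc hJ hM
    have hd : (J, F, P, C) ∈ D := ⟨Set.mem_univ _, hF, hP.trans hF,
      hC.trans (Set.prod_mono hF (Set.prod_mono hF subset_rfl))⟩
    refine ⟨_, ⟨⟨(J, F, P, C), hd, (Γ, N), hΓ, hN, hdat⟩, rfl⟩, ?_⟩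
    exact hdat.exists_mulEquiv (hf ⟨(J, F, P, C), hd, (Γ, N), hΓ, hN, hdat⟩).2.2
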